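/- arXiv:2011.00807 — 3 statements merged into one kernel-verified Lean document; each statement's English description precedes it below -/
import Mathlib

section
/- Let A ⊂ [0,∞) be measurable with μ(A) = t < ∞. Then the Orlicz norm of the characteristic function of A in the Orlicz–Lorentz space satisfies ‖χ_A‖°_{φ,ω} = ψ⁻¹(1/W(t)) · W(t), where ψ⁻¹ is the inverse of the complementary function ψ and W(t) = ∫₀ᵗ ω(s) ds. -/
open MeasureTheory Set Filter Topology
open scoped ENNReal

noncomputable section

/-- An Orlicz function: convex, even, vanishing only at `0`, with
`φ(u)/u → 0` as `u → 0⁺` and `φ(u)/u → ∞` as `u → ∞`. -/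
def IsOrliczFunction (φ : ℝ → ℝ) : Prop :=
  ConvexOn ℝ Set.univ φ ∧ (∀ u, φ (-u) = φ u) ∧ φ 0 = 0 ∧
    (∀ u : ℝ, 0 < u → 0 < φ u) ∧ (∀ u : ℝ, 0 ≤ φ u) ∧
    Filter.Tendsto (fun u => φ u / u) (nhdsWithin 0 (Set.Ioi 0)) (nhds 0) ∧
    Filter.Tendsto (fun u => φ u / u) Filter.atTop Filter.atTop

/-- The complementary (conjugate) Orlicz function `ψ(v) = sup_{u>0} (|uv| - φ(u))`. -/
def complementaryFn (φ : ℝ → ℝ) (v : ℝ) : ℝ :=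
  sSup {w | ∃ u : ℝ, 0 < u ∧ w = |u * v| - φ u}

/-- The `Δ₂` condition for all values. -/
def Delta2All (φ : ℝ → ℝ) : Prop :=
  ∃ K : ℝ, 0 < K ∧ ∀ u : ℝ, φ (2 * u) ≤ K * φ u

/-- The `Δ₂` condition for large values. -/
def Delta2Large (φ : ℝ → ℝ) : Prop :=
  ∃ K : ℝ, 0 < K ∧ ∃ u₀ : ℝ, 0 ≤ u₀ ∧ ∀ u : ℝ, u₀ ≤ u → φ (2 * u) ≤ K * φ u

/-- The interval `[0, γ)` viewed inside `ℝ`, where `γ ≤ ∞`. -/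
def domSet (γ : ℝ≥0∞) : Set ℝ := {s : ℝ | 0 ≤ s ∧ (ENNReal.ofReal s) < γ}

/-- The decreasing rearrangement of `x` (with underlying domain `D`):
`x*(t) = inf {θ > 0 : μ{s ∈ D : |x(s)| > θ} ≤ t}`. -/
def rearr (D : Set ℝ) (x : ℝ → ℝ) (t : ℝ) : ℝ :=
  sInf {θ : ℝ | 0 < θ ∧ volume {s ∈ D | θ < |x s|} ≤ ENNReal.ofReal t}

/-- A weight function on `D`: non-increasing, non-negative and locally integrable. -/
def IsWeight (D : Set ℝ) (ω : ℝ → ℝ) : Prop :=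
  (∀ t ∈ D, 0 ≤ ω t) ∧ AntitoneOn ω D ∧
    ∀ t : ℝ, IntegrableOn ω (D ∩ Set.Icc 0 t) volume

/-- The modular `ρ_{φ,ω}(x) = ∫_D φ(x*(t)) ω(t) dt`. -/
def olModular (D : Set ℝ) (φ ω x : ℝ → ℝ) : ℝ≥0∞ :=
  ∫⁻ t in D, ENNReal.ofReal (φ (rearr D x t) * ω t)

/-- Membership in the Orlicz–Lorentz space `Λ_{φ,ω}`. -/
def MemOL (D : Set ℝ) (φ ω x : ℝ → ℝ) : Prop :=
  Measurable x ∧ ∃ l : ℝ, 0 < l ∧ olModular D φ ω (fun t => l * x t) < ⊤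

/-- The Orlicz (Amemiya) norm `‖x‖° = inf_{k>0} (1 + ρ_{φ,ω}(kx))/k`. -/
def orliczNorm (D : Set ℝ) (φ ω x : ℝ → ℝ) : ℝ≥0∞ :=
  ⨅ k ∈ Set.Ioi (0:ℝ), (1 + olModular D φ ω (fun t => k * x t)) / ENNReal.ofReal k

/-- The Luxemburg norm `‖x‖ = inf {ε > 0 : ρ_{φ,ω}(x/ε) ≤ 1}`. -/
def luxNorm (D : Set ℝ) (φ ω x : ℝ → ℝ) : ℝ :=
  sInf {ε : ℝ | 0 < ε ∧ olModular D φ ω (fun t => x t / ε) ≤ 1}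

/-- `K(x) = {k > 0 : ‖x‖° = (1 + ρ_{φ,ω}(kx))/k}`. -/
def KSet (D : Set ℝ) (φ ω x : ℝ → ℝ) : Set ℝ :=
  {k : ℝ | 0 < k ∧
    orliczNorm D φ ω x = (1 + olModular D φ ω (fun t => k * x t)) / ENNReal.ofReal k}

/-- The Lorentz norm `‖x‖_{1,ω} = ∫_D x*(t) ω(t) dt`. -/
def lorentzNorm (D : Set ℝ) (ω x : ℝ → ℝ) : ℝ≥0∞ :=
  ∫⁻ t in D, ENNReal.ofReal (rearr D x t * ω t)

/-- The (generalized right-continuous) inverse of an Orlicz function. -/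
def orliczInv (ψ : ℝ → ℝ) (v : ℝ) : ℝ :=
  sSup {u : ℝ | 0 ≤ u ∧ ψ u ≤ v}

/-- The right derivative of `φ`, as the infimum of right slopes. -/
def rightDerivOf (φ : ℝ → ℝ) (u : ℝ) : ℝ :=
  sInf {r : ℝ | ∃ v : ℝ, u < v ∧ r = (φ v - φ u) / (v - u)}


theorem rearr_const_mul_indicator {D A : Set ℝ} (hA : A ⊆ D) {t k : ℝ}
    (hvol : volume A = ENNReal.ofReal t) (hk : 0 < k) {s : ℝ} (hs : 0 ≤ s) :
    rearr D (fun r => k * A.indicator (fun _ => (1 : ℝ)) r) s = if s < t then k else 0 := by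
  have level_of_lt : ∀ θ : ℝ, 0 < θ → θ < k →
      {r ∈ D | θ < |k * A.indicator (fun _ => (1 : ℝ)) r|} = A := by
    intro θ h0 h
    ext r
    by_cases hr : r ∈ A
    · simp [hr, hA hr, abs_of_pos hk, h]
    · simp [hr, h0.le]
  have level_of_le : ∀ θ : ℝ, 0 < θ → k ≤ θ →
      {r ∈ D | θ < |k * A.indicator (fun _ => (1 : ℝ)) r|} = ∅ := by
    intro θ h0 h
    ext r
    by_cases hr : r ∈ A
    · simp [hr, abs_of_pos hk, h]
    · simp [hr, h0.le]
  unfold rearr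
  split_ifs with hst
  · have h : {θ : ℝ | 0 < θ ∧ volume {r ∈ D | θ < |k * A.indicator (fun _ => (1 : ℝ)) r|}
        ≤ ENNReal.ofReal s} = Set.Ici k := by
      ext θ
      simp only [Set.mem_ofPred_eq, Set.mem_Ici]
      constructor
      · rintro ⟨h0, h⟩
        by_contra! hlt
        rw [level_of_lt θ h0 hlt, hvol, ENNReal.ofReal_le_ofReal_iff hs] at h
        linarith
      · intro h
        have h0 := hk.trans_le h
        exact ⟨h0, by rw [level_of_le θ h0 h]; simp⟩
    rw [h, csInf_Ici]
  · have h : {θ : ℝ | 0 < θ ∧ volume {r ∈ D | θ < |k * A.indicator (fun _ => (1 : ℝ)) r|}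
        ≤ ENNReal.ofReal s} = Set.Ioi 0 := by
      ext θ
      simp only [Set.mem_ofPred_eq, Set.mem_Ioi, and_iff_left_iff_imp]
      intro h0
      rcases lt_or_ge θ k with h | h
      · rw [level_of_lt θ h0 h, hvol]
        exact ENNReal.ofReal_le_ofReal (not_lt.1 hst)
      · rw [level_of_le θ h0 h]
        simp
    rw [h, csInf_Ioi]

theorem olModular_const_mul_indicator {φ ω : ℝ → ℝ} (h0 : φ 0 = 0) (hφ : ∀ u, 0 ≤ φ u)
    (hω : IsWeight (Set.Ici 0) ω) {A : Set ℝ} (hA : A ⊆ Set.Ici 0) {t k : ℝ} (ht : 0 ≤ t)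
    (hvol : volume A = ENNReal.ofReal t) (hk : 0 < k) :
    olModular (Set.Ici 0) φ ω (fun r => k * A.indicator (fun _ => (1 : ℝ)) r) =
      ENNReal.ofReal (φ k * ∫ s in (0 : ℝ)..t, ω s) := by
  have hint : IntegrableOn ω (Set.Ico 0 t) := by
    refine (hω.2.2 t).mono_set fun s hs => ?_
    exact ⟨hs.1, hs.1, hs.2.le⟩
  have hind : ∀ s ∈ Set.Ici (0 : ℝ),
      ENNReal.ofReal (φ (rearr (Set.Ici 0) (fun r => k * A.indicator (fun _ => (1 : ℝ)) r) s) * ω s)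
        = (Set.Ico 0 t).indicator (fun s => ENNReal.ofReal (φ k * ω s)) s := by
    intro s hs
    rw [rearr_const_mul_indicator hA hvol hk hs]
    by_cases hst : s < t
    · have hmem : s ∈ Set.Ico 0 t := ⟨hs, hst⟩
      rw [if_pos hst, Set.indicator_of_mem hmem]
    · have hmem : s ∉ Set.Ico 0 t := fun h => hst h.2
      rw [if_neg hst, Set.indicator_of_notMem hmem, h0, zero_mul, ENNReal.ofReal_zero]
  unfold olModular
  rw [setLIntegral_congr_fun measurableSet_Ici hind, setLIntegral_indicator measurableSet_Ico,
    Set.inter_eq_left.2 (fun s hs => hs.1),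
    ← ofReal_integral_eq_lintegral_ofReal (hint.const_mul _), integral_const_mul,
    intervalIntegral.integral_of_le ht, integral_Ico_eq_integral_Ioo,
    integral_Ioc_eq_integral_Ioo]
  filter_upwards [ae_restrict_mem measurableSet_Ico] with s hs
  exact mul_nonneg (hφ k) (hω.1 s hs.1)

theorem complementaryFn_le_iff {φ : ℝ → ℝ} (hφ : ∀ u, 0 ≤ φ u)
    (htop : Tendsto (fun u => φ u / u) atTop atTop) {v a : ℝ} (hv : 0 ≤ v) :
    complementaryFn φ v ≤ a ↔ ∀ u, 0 < u → u * v ≤ a + φ u := by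
  obtain ⟨M, hM⟩ := eventually_atTop.1 (htop.eventually_ge_atTop v)
  have hbdd : BddAbove {w | ∃ u : ℝ, 0 < u ∧ w = |u * v| - φ u} := by
    refine ⟨max 0 (M * v), ?_⟩
    rintro w ⟨u, hu, rfl⟩
    rw [abs_of_nonneg (mul_nonneg hu.le hv)]
    rcases le_total M u with h | h
    · have := (le_div_iff₀ hu).1 (hM u h)
      exact le_max_of_le_left (by linarith)
    · have := mul_le_mul_of_nonneg_right h hv
      exact le_max_of_le_right (by linarith [hφ u])
  unfold complementaryFn
  rw [csSup_le_iff hbdd ⟨_, 1, one_pos, rfl⟩]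
  constructor
  · intro h u hu
    have := h _ ⟨u, hu, rfl⟩
    rw [abs_of_nonneg (mul_nonneg hu.le hv)] at this
    linarith
  · rintro h w ⟨u, hu, rfl⟩
    rw [abs_of_nonneg (mul_nonneg hu.le hv)]
    linarith [h u hu]

/-- For `a ≥ 0`, the generalized inverse of the complementary function at `a` is the greatest
lower bound of `(a + φ u) / u` over `u > 0`. -/
theorem isGLB_orliczInv_complementaryFn {φ : ℝ → ℝ} (hφ : ∀ u, 0 ≤ φ u)
    (htop : Tendsto (fun u => φ u / u) atTop atTop) {a : ℝ} (ha : 0 ≤ a) :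
    IsGLB ((fun u => (a + φ u) / u) '' Set.Ioi 0) (orliczInv (complementaryFn φ) a) := by
  have hmem : ∀ v : ℝ, v ∈ {v : ℝ | 0 ≤ v ∧ complementaryFn φ v ≤ a} ↔
      0 ≤ v ∧ ∀ u, 0 < u → v ≤ (a + φ u) / u := by
    intro v
    refine and_congr_right fun hv => ?_
    rw [complementaryFn_le_iff hφ htop hv]
    refine forall₂_congr fun u hu => ?_
    rw [le_div_iff₀ hu, mul_comm]
  have hnn : ∀ u, 0 < u → 0 ≤ (a + φ u) / u := fun u hu =>
    div_nonneg (add_nonneg ha (hφ u)) hu.le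
  constructor
  · rintro _ ⟨u, hu, rfl⟩
    exact csSup_le ⟨0, (hmem 0).2 ⟨le_rfl, hnn⟩⟩ fun v hv => ((hmem v).1 hv).2 u hu
  · intro b hb
    have hbdd : BddAbove {v : ℝ | 0 ≤ v ∧ complementaryFn φ v ≤ a} :=
      ⟨(a + φ 1) / 1, fun v hv => ((hmem v).1 hv).2 1 one_pos⟩
    refine (le_max_left b 0).trans (le_csSup hbdd ((hmem _).2 ⟨le_max_right _ _, fun u hu => ?_⟩))
    exact max_le (hb ⟨u, hu, rfl⟩) (hnn u hu)

/-- For measurable `A ⊆ [0,∞)` with `μ(A) = t < ∞`,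
`‖χ_A‖°_{φ,ω} = ψ⁻¹(1/W(t))·W(t)` where `W(t) = ∫₀ᵗ ω(s) ds`. -/
theorem orliczNorm_indicator_finite_measure
    (φ ω : ℝ → ℝ) (hφ : IsOrliczFunction φ) (hω : IsWeight (Set.Ici 0) ω)
    (A : Set ℝ) (hA : A ⊆ Set.Ici 0) (hAm : MeasurableSet A)
    (t : ℝ) (ht : 0 ≤ t) (hvol : volume A = ENNReal.ofReal t) :
    orliczNorm (Set.Ici 0) φ ω (A.indicator fun _ => (1:ℝ)) =
      ENNReal.ofReal
        (orliczInv (complementaryFn φ) (1 / ∫ s in (0:ℝ)..t, ω s) *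
          ∫ s in (0:ℝ)..t, ω s) := by
  obtain ⟨-, -, h0, -, hnn, -, htop⟩ := hφ
  have hWnn : 0 ≤ ∫ s in (0 : ℝ)..t, ω s :=
    intervalIntegral.integral_nonneg ht fun s hs => hω.1 s hs.1
  have hmod : ∀ k ∈ Set.Ioi (0 : ℝ),
      (1 + olModular (Set.Ici 0) φ ω (fun r => k * A.indicator (fun _ => (1 : ℝ)) r)) /
        ENNReal.ofReal k = ENNReal.ofReal ((1 + φ k * ∫ s in (0 : ℝ)..t, ω s) / k) := by
    intro k hk
    rw [olModular_const_mul_indicator h0 hnn hω hA ht hvol hk, ENNReal.ofReal_div_of_pos hk,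
      ENNReal.ofReal_add zero_le_one (mul_nonneg (hnn k) hWnn), ENNReal.ofReal_one]
  unfold orliczNorm
  rw [biInf_congr hmod]
  generalize (∫ s in (0 : ℝ)..t, ω s) = W at hWnn
  refine le_antisymm (le_of_forall_gt fun c hc => ?_) (le_iInf₂ fun k hk => ?_)
  · simp only [iInf_lt_iff, exists_prop]
    rcases hWnn.eq_or_lt with rfl | hW
    · rw [mul_zero, ENNReal.ofReal_zero] at hc
      obtain ⟨r, -, hrc⟩ := ENNReal.lt_iff_exists_real_btwn.1 hc
      have hr0 : 0 < r := ENNReal.ofReal_pos.1 hrc.1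
      exact ⟨r⁻¹, inv_pos.2 hr0, by simpa using hrc.2⟩
    · obtain ⟨r, -, hlt, hrc⟩ := ENNReal.lt_iff_exists_real_btwn.1 hc
      have hlt' := (lt_div_iff₀ hW).2 ((ENNReal.ofReal_lt_ofReal_iff').1 hlt).1
      obtain ⟨_, ⟨k, hk, rfl⟩, -, hkr⟩ :=
        (isGLB_orliczInv_complementaryFn hnn htop (one_div_nonneg.2 hW.le)).exists_between hlt'
      refine ⟨k, hk, (ENNReal.ofReal_le_ofReal ?_).trans_lt hrc⟩
      have := ((lt_div_iff₀ hW).1 hkr).le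
      refine le_of_eq_of_le ?_ this
      field_simp
  · refine ENNReal.ofReal_le_ofReal ?_
    rcases hWnn.eq_or_lt with rfl | hW
    · simpa using (Set.mem_Ioi.1 hk).le
    · have := (isGLB_orliczInv_complementaryFn hnn htop (one_div_nonneg.2 hW.le)).1 ⟨k, hk, rfl⟩
      refine (mul_le_mul_of_nonneg_right this hW.le).trans_eq ?_
      field_simp
end
end

section
/- Suppose ∫₀^∞ ω(t) dt = ∞ and ω is positive on [0,∞). Let x, y be in the unit sphere of Λ°_{φ,ω}[0,∞), let k₁ ∈ K(x), k₂ ∈ K(y), and set k = 2k₁k₂/(k₁+k₂). If μ{t : x(t)y(t) > 0} > 0, then ρ_{φ,ω}(k(x−y)/2) < k − 1, and consequently ‖(x−y)/2‖°_{φ,ω} < 1. If μ{t : x(t)y(t) < 0, or x(t)y(t) = 0 and max{|x(t)|,|y(t)|} > 0} > 0, then ρ_{φ,ω}(k(x+y)/2) < k − 1, and consequently ‖(x+y)/2‖°_{φ,ω} < 1. -/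
open MeasureTheory Set Filter Topology
open scoped ENNReal

noncomputable section

/-- The truncated layer-cake integral `∫₀^∞ min (m, μ{f > θ}) dθ`, which equals `∫₀^m f*(t) dt`. -/
def truncLayer {α : Type*} [MeasurableSpace α] (μ : Measure α) (m : ℝ≥0∞) (f : α → ℝ) : ℝ≥0∞ :=
  ∫⁻ θ in Ioi (0:ℝ), min m (μ {s | θ < f s})

theorem antitone_measure_lt {α : Type*} [MeasurableSpace α] (μ : Measure α) (f : α → ℝ) :
    Antitone fun θ : ℝ => μ {s | θ < f s} :=
  fun _ _ h => measure_mono fun _ hs => lt_of_le_of_lt h hs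

theorem setLIntegral_Ioi_measure_lt {α : Type*} [MeasurableSpace α] (μ : Measure α) {f : α → ℝ}
    (hf : Measurable f) (c : ℝ) :
    ∫⁻ θ in Ioi c, μ {s | θ < f s} = ∫⁻ s, ENNReal.ofReal (f s - c) ∂μ := by
  have h1 : ∫⁻ s, ENNReal.ofReal (f s - c) ∂μ = ∫⁻ s, ENNReal.ofReal (max (f s - c) 0) ∂μ := by
    refine lintegral_congr fun s => ?_
    rcases le_total (f s - c) 0 with h | h
    · rw [max_eq_right h, ENNReal.ofReal_of_nonpos h, ENNReal.ofReal_zero]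
    · rw [max_eq_left h]
  rw [h1, lintegral_eq_lintegral_meas_lt (f := fun s => max (f s - c) 0) μ
    (Eventually.of_forall fun s => le_max_right _ _)
    ((hf.sub_const c).max measurable_const).aemeasurable,
    ← (measurePreserving_add_right volume c).setLIntegral_comp_preimage measurableSet_Ioi
      (antitone_measure_lt μ f).measurable]
  have h2 : (fun x : ℝ => x + c) ⁻¹' Ioi c = Ioi 0 := by ext; simp
  rw [h2]
  refine setLIntegral_congr_fun measurableSet_Ioi fun θ hθ => ?_
  have hθ' : (0:ℝ) < θ := hθ
  congr 1
  ext s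
  simp only [mem_ofPred_eq, lt_max_iff]
  constructor
  · intro h; left; linarith
  · rintro (h | h) <;> linarith

theorem truncLayer_le {α : Type*} [MeasurableSpace α] (μ : Measure α) (m : ℝ≥0∞) {f : α → ℝ}
    (hf : Measurable f) {c : ℝ} (hc : 0 ≤ c) :
    truncLayer μ m f ≤ m * ENNReal.ofReal c + ∫⁻ s, ENNReal.ofReal (f s - c) ∂μ := by
  rw [← setLIntegral_Ioi_measure_lt μ hf, truncLayer, ← Ioc_union_Ioi_eq_Ioi hc,
    lintegral_union measurableSet_Ioi (Ioc_disjoint_Ioi le_rfl)]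
  refine add_le_add ?_ (lintegral_mono fun θ => min_le_right _ _)
  calc _ ≤ ∫⁻ θ in Ioc 0 c, m := lintegral_mono fun θ => min_le_left _ _
    _ = _ := by simp

theorem exists_le_truncLayer {α : Type*} [MeasurableSpace α] (μ : Measure α) {m : ℝ≥0∞}
    (hm : m ≠ 0) {f : α → ℝ} (hf : Measurable f) (h : truncLayer μ m f ≠ ⊤) :
    ∃ c : ℝ, 0 ≤ c ∧
      m * ENNReal.ofReal c + ∫⁻ s, ENNReal.ofReal (f s - c) ∂μ ≤ truncLayer μ m f := by
  set S : Set ℝ := {θ | 0 ≤ θ ∧ μ {s | θ < f s} ≤ m} with hS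
  have hne : S.Nonempty := by
    by_contra hemp
    apply h
    rw [not_nonempty_iff_eq_empty] at hemp
    have : truncLayer μ m f = ∫⁻ θ in Ioi (0:ℝ), m := by
      refine setLIntegral_congr_fun measurableSet_Ioi fun θ hθ => min_eq_left ?_
      by_contra hlt
      have : θ ∈ S := ⟨le_of_lt hθ, (not_le.1 hlt).le⟩
      simp [hemp] at this
    rw [this]
    simp [ENNReal.mul_top hm]
  have hbdd : BddBelow S := ⟨0, fun θ hθ => hθ.1⟩
  have hc : 0 ≤ sInf S := le_csInf hne fun θ hθ => hθ.1
  refine ⟨sInf S, hc, ?_⟩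
  rw [← setLIntegral_Ioi_measure_lt μ hf, truncLayer, ← Ioc_union_Ioi_eq_Ioi hc,
    lintegral_union measurableSet_Ioi (Ioc_disjoint_Ioi le_rfl)]
  refine add_le_add ?_ ?_
  · rw [← restrict_Ioo_eq_restrict_Ioc]
    calc m * ENNReal.ofReal (sInf S) = ∫⁻ θ in Ioo 0 (sInf S), m := by simp
      _ ≤ _ := by
        refine setLIntegral_mono' measurableSet_Ioo fun θ hθ => le_min le_rfl ?_
        by_contra hlt
        exact absurd (csInf_le hbdd ⟨hθ.1.le, (not_le.1 hlt).le⟩) (not_le.2 hθ.2)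
  · refine setLIntegral_mono' measurableSet_Ioi fun θ hθ => le_min ?_ le_rfl
    obtain ⟨η, hη, hlt⟩ := exists_lt_of_csInf_lt hne hθ
    exact (antitone_measure_lt μ f hlt.le).trans hη.2

theorem truncLayer_convex {α : Type*} [MeasurableSpace α] (μ : Measure α) (m : ℝ≥0∞)
    {f g : α → ℝ} (hf : Measurable f) (hg : Measurable g) {a b : ℝ} (ha : 0 < a) (hb : 0 < b) :
    truncLayer μ m (fun s => a * f s + b * g s) ≤
      ENNReal.ofReal a * truncLayer μ m f + ENNReal.ofReal b * truncLayer μ m g := by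
  rcases eq_or_ne m 0 with rfl | hm
  · simp [truncLayer]
  have ha' : ENNReal.ofReal a ≠ 0 := by simpa using ha
  have hb' : ENNReal.ofReal b ≠ 0 := by simpa using hb
  by_cases hft : truncLayer μ m f = ⊤
  · simp [hft, ENNReal.mul_top ha']
  by_cases hgt : truncLayer μ m g = ⊤
  · simp [hgt, ENNReal.mul_top hb']
  obtain ⟨c, hc, hcf⟩ := exists_le_truncLayer μ hm hf hft
  obtain ⟨d, hd, hdg⟩ := exists_le_truncLayer μ hm hg hgt
  refine (truncLayer_le μ m ((hf.const_mul a).add (hg.const_mul b))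
    (c := a * c + b * d) (by positivity)).trans ?_
  refine le_trans ?_ (add_le_add (mul_le_mul_right hcf _) (mul_le_mul_right hdg _))
  have hintegral : ∫⁻ s, ENNReal.ofReal (a * f s + b * g s - (a * c + b * d)) ∂μ ≤
      ENNReal.ofReal a * ∫⁻ s, ENNReal.ofReal (f s - c) ∂μ +
        ENNReal.ofReal b * ∫⁻ s, ENNReal.ofReal (g s - d) ∂μ := by
    rw [← lintegral_const_mul _ (hf.sub_const c).ennreal_ofReal,
      ← lintegral_const_mul _ (hg.sub_const d).ennreal_ofReal,
      ← lintegral_add_left ((hf.sub_const c).ennreal_ofReal.const_mul _)]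
    refine lintegral_mono fun s => ?_
    rw [← ENNReal.ofReal_mul ha.le, ← ENNReal.ofReal_mul hb.le,
      show a * f s + b * g s - (a * c + b * d) = a * (f s - c) + b * (g s - d) by ring]
    exact ENNReal.ofReal_add_le
  refine (add_le_add_right hintegral _).trans (le_of_eq ?_)
  rw [ENNReal.ofReal_add (by positivity) (by positivity), ENNReal.ofReal_mul ha.le,
    ENNReal.ofReal_mul hb.le]
  ring

theorem measurableSet_domSet (d : ℝ≥0∞) : MeasurableSet (domSet d) :=
  (measurableSet_le measurable_const measurable_id).inter
    (measurableSet_lt ENNReal.measurable_ofReal measurable_const)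

theorem domSet_mono {c d : ℝ≥0∞} (h : c ≤ d) : domSet c ⊆ domSet d :=
  fun _ ht => ⟨ht.1, ht.2.trans_le h⟩

theorem domSet_top : domSet ⊤ = Ici 0 := by
  ext t; simp [domSet]

theorem domSet_ofReal (d : ℝ) : domSet (ENNReal.ofReal d) = Ico 0 d := by
  ext t
  constructor
  · rintro ⟨h0, h⟩
    exact ⟨h0, (ENNReal.ofReal_lt_ofReal_iff_of_nonneg h0).1 h⟩
  · rintro ⟨h0, h⟩
    exact ⟨h0, (ENNReal.ofReal_lt_ofReal_iff_of_nonneg h0).2 h⟩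

theorem volume_domSet (d : ℝ≥0∞) : volume (domSet d) = d := by
  induction d with
  | top => simp [domSet_top]
  | coe d => rw [← ENNReal.ofReal_coe_nnreal, domSet_ofReal]; simp

/-- The primitive `∫₀^d ω(t) dt` of a weight, for `d ∈ [0, ∞]`. -/
def weightPrimitive (ω : ℝ → ℝ) (d : ℝ≥0∞) : ℝ≥0∞ :=
  ∫⁻ t in domSet d, ENNReal.ofReal (ω t)

theorem weightPrimitive_mono (ω : ℝ → ℝ) : Monotone (weightPrimitive ω) :=
  fun _ _ h => lintegral_mono_set (domSet_mono h)

theorem IsWeight.aemeasurable {ω : ℝ → ℝ} (hω : IsWeight (Ici 0) ω) :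
    AEMeasurable ω (volume.restrict (Ici 0)) :=
  aemeasurable_restrict_of_antitoneOn measurableSet_Ici hω.2.1

theorem IsWeight.weightPrimitive_eq {ω : ℝ → ℝ} (hω : IsWeight (Ici 0) ω) (d : ℝ≥0∞) :
    weightPrimitive ω d =
      ∫⁻ r in Ioi (0:ℝ), min (volume.restrict (Ici 0) {t | r < ω t}) d := by
  have hsub : domSet d ⊆ Ici 0 := fun t ht => ht.1
  rw [weightPrimitive, lintegral_eq_lintegral_meas_lt]
  · refine lintegral_congr fun r => ?_
    rw [Measure.restrict_apply' (measurableSet_domSet d),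
      Measure.restrict_apply' measurableSet_Ici]
    nth_rewrite 2 [← volume_domSet d]
    by_cases h : {t | r < ω t} ∩ Ici 0 ⊆ domSet d
    · rw [min_eq_left (measure_mono h)]
      congr 1
      exact Subset.antisymm (fun t ht => ⟨ht.1, hsub ht.2⟩) fun t ht => ⟨ht.1, h ht⟩
    · obtain ⟨a, ⟨har, ha0⟩, had⟩ := not_subset.1 h
      have hsub' : domSet d ⊆ {t | r < ω t} := by
        intro t ht
        have hta : t ≤ a := by
          by_contra hlt
          exact had ⟨ha0, (ENNReal.ofReal_le_ofReal (not_le.1 hlt).le).trans_lt ht.2⟩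
        exact lt_of_lt_of_le har (hω.2.1 ht.1 ha0 hta)
      rw [inter_eq_right.2 hsub', min_eq_right (measure_mono (subset_inter hsub' hsub))]
  · exact ae_restrict_of_forall_mem (measurableSet_domSet d) fun t ht => hω.1 t ht.1
  · exact hω.aemeasurable.mono_measure (Measure.restrict_mono hsub le_rfl)

theorem IsWeight.weightPrimitive_lt_top {ω : ℝ → ℝ} (hω : IsWeight (Ici 0) ω) {d : ℝ≥0∞}
    (hd : d ≠ ⊤) : weightPrimitive ω d < ⊤ := by
  rw [weightPrimitive, ← ENNReal.ofReal_toReal hd, domSet_ofReal]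
  refine lt_of_le_of_lt (lintegral_mono_set (t := Ici 0 ∩ Icc 0 d.toReal) ?_)
    (Integrable.lintegral_lt_top (hω.2.2 d.toReal))
  exact fun t ht => ⟨ht.1, ht.1, ht.2.le⟩

theorem IsWeight.weightPrimitive_lt {ω : ℝ → ℝ} (hω : IsWeight (Ici 0) ω)
    (hωpos : ∀ t ∈ Ici (0:ℝ), 0 < ω t) {c d : ℝ≥0∞} (hcd : c < d) (hd : d ≠ ⊤) :
    weightPrimitive ω c < weightPrimitive ω d := by
  have hc : c ≠ ⊤ := (hcd.trans_le le_top).ne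
  have hlt : c.toReal < d.toReal := (ENNReal.toReal_lt_toReal hc hd).2 hcd
  have hfin := hω.weightPrimitive_lt_top hc
  simp only [weightPrimitive] at hfin ⊢
  have hdomSet {e : ℝ≥0∞} (he : e ≠ ⊤) : domSet e = Ico 0 e.toReal := by
    rw [← domSet_ofReal, ENNReal.ofReal_toReal he]
  rw [hdomSet hc] at hfin ⊢
  rw [hdomSet hd, ← Ico_union_Ico_eq_Ico ENNReal.toReal_nonneg hlt.le,
    lintegral_union measurableSet_Ico (Ico_disjoint_Ico_same)]
  refine ENNReal.lt_add_right hfin.ne (ne_of_gt ?_)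
  calc 0 < ENNReal.ofReal (ω d.toReal) * ENNReal.ofReal (d.toReal - c.toReal) :=
        ENNReal.mul_pos (by simpa using hωpos _ ENNReal.toReal_nonneg) (by simpa using hlt)
    _ = ∫⁻ t in Ico c.toReal d.toReal, ENNReal.ofReal (ω d.toReal) := by simp
    _ ≤ _ := setLIntegral_mono' measurableSet_Ico fun t ht => ENNReal.ofReal_le_ofReal
        (hω.2.1 (ENNReal.toReal_nonneg.trans ht.1) ENNReal.toReal_nonneg ht.2.le)

/-- The layer-cake form `∫₀^∞ W(μ{f > θ}) dθ` of `∫₀^∞ f*(t) ω(t) dt`, with `W` the primitive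
of `ω`. -/
def weightedLayer {α : Type*} [MeasurableSpace α] (μ : Measure α) (ω : ℝ → ℝ) (f : α → ℝ) :
    ℝ≥0∞ :=
  ∫⁻ θ in Ioi (0:ℝ), weightPrimitive ω (μ {s | θ < f s})

theorem antitone_weightPrimitive_measure_lt {α : Type*} [MeasurableSpace α] (μ : Measure α)
    (ω : ℝ → ℝ) (f : α → ℝ) : Antitone fun θ : ℝ => weightPrimitive ω (μ {s | θ < f s}) :=
  (weightPrimitive_mono ω).comp_antitone (antitone_measure_lt μ f)

theorem IsWeight.weightedLayer_eq {α : Type*} [MeasurableSpace α] (μ : Measure α)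
    {ω : ℝ → ℝ} (hω : IsWeight (Ici 0) ω) (f : α → ℝ) :
    weightedLayer μ ω f =
      ∫⁻ r in Ioi (0:ℝ), truncLayer μ (volume.restrict (Ici 0) {t | r < ω t}) f := by
  simp only [weightedLayer, hω.weightPrimitive_eq, truncLayer]
  refine lintegral_lintegral_swap (Measurable.aemeasurable ?_)
  exact ((antitone_measure_lt _ ω).measurable.comp measurable_snd).min
    ((antitone_measure_lt μ f).measurable.comp measurable_fst)

theorem measurable_truncLayer {α : Type*} [MeasurableSpace α] (μ : Measure α) (f : α → ℝ) :
    Measurable fun m => truncLayer μ m f :=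
  Monotone.measurable fun _ _ h => lintegral_mono fun _ => min_le_min_right _ h

theorem IsWeight.weightedLayer_convex {α : Type*} [MeasurableSpace α] (μ : Measure α)
    {ω : ℝ → ℝ} (hω : IsWeight (Ici 0) ω) {f g : α → ℝ} (hf : Measurable f) (hg : Measurable g)
    {a b : ℝ} (ha : 0 < a) (hb : 0 < b) :
    weightedLayer μ ω (fun s => a * f s + b * g s) ≤
      ENNReal.ofReal a * weightedLayer μ ω f + ENNReal.ofReal b * weightedLayer μ ω g := by
  have hmeas (h : α → ℝ) : Measurable fun r : ℝ =>
      truncLayer μ (volume.restrict (Ici 0) {t | r < ω t}) h :=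
    (measurable_truncLayer μ h).comp (antitone_measure_lt _ ω).measurable
  simp only [hω.weightedLayer_eq]
  rw [← lintegral_const_mul _ (hmeas f), ← lintegral_const_mul _ (hmeas g),
    ← lintegral_add_left ((hmeas f).const_mul _)]
  exact lintegral_mono fun r => truncLayer_convex μ _ hf hg ha hb

theorem measure_lt_ne_top_of_weightedLayer {α : Type*} [MeasurableSpace α] {μ : Measure α}
    {ω : ℝ → ℝ} (hωint : (∫⁻ t in Ici (0:ℝ), ENNReal.ofReal (ω t)) = ⊤) {f : α → ℝ}
    (h : weightedLayer μ ω f ≠ ⊤) {θ : ℝ} (hθ : 0 < θ) : μ {s | θ < f s} ≠ ⊤ := by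
  intro htop
  apply h
  rw [eq_top_iff]
  have htop' : weightPrimitive ω (μ {s | θ < f s}) = ⊤ := by
    rw [htop, weightPrimitive, domSet_top, hωint]
  calc ⊤ = ∫⁻ _ in Ioc 0 θ, (⊤ : ℝ≥0∞) := by simp [ENNReal.top_mul, hθ]
    _ ≤ ∫⁻ η in Ioc 0 θ, weightPrimitive ω (μ {s | η < f s}) :=
        setLIntegral_mono' measurableSet_Ioc fun η hη =>
          htop'.symm.le.trans (antitone_weightPrimitive_measure_lt μ ω f hη.2)
    _ ≤ _ := lintegral_mono_set Ioc_subset_Ioi_self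

theorem weightedLayer_mono {α : Type*} [MeasurableSpace α] (μ : Measure α) (ω : ℝ → ℝ)
    {f g : α → ℝ} (hfg : ∀ s, f s ≤ g s) : weightedLayer μ ω f ≤ weightedLayer μ ω g :=
  lintegral_mono fun _ => weightPrimitive_mono ω
    (measure_mono fun s hs => lt_of_lt_of_le hs (hfg s))

theorem IsWeight.weightedLayer_lt {α : Type*} [MeasurableSpace α] {μ : Measure α} {ω : ℝ → ℝ}
    (hω : IsWeight (Ici 0) ω) (hωpos : ∀ t ∈ Ici (0:ℝ), 0 < ω t)
    (hωint : (∫⁻ t in Ici (0:ℝ), ENNReal.ofReal (ω t)) = ⊤) {f g : α → ℝ}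
    (hf : Measurable f) (hf0 : ∀ s, 0 ≤ f s) (hfg : ∀ s, f s ≤ g s)
    (hpos : μ {s | f s < g s} ≠ 0) (hgt : weightedLayer μ ω g ≠ ⊤) :
    weightedLayer μ ω f < weightedLayer μ ω g := by
  obtain ⟨p, q, hpq, hpos'⟩ : ∃ p q : ℚ, (p:ℝ) < q ∧ μ {s | f s < p ∧ q < g s} ≠ 0 := by
    by_contra! hcon
    refine hpos (measure_mono_null (t := ⋃ p : ℚ, ⋃ q : ℚ, ⋃ _ : (p:ℝ) < q,
      {s | f s < p ∧ q < g s}) (fun s (hs : f s < g s) => ?_) ?_)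
    · obtain ⟨p, hp, hp'⟩ := exists_rat_btwn hs
      obtain ⟨q, hq, hq'⟩ := exists_rat_btwn hp'
      simp only [mem_iUnion]
      exact ⟨p, q, hq, hp, hq'⟩
    · simpa only [measure_iUnion_null_iff] using hcon
  obtain ⟨s₀, hs₀⟩ := nonempty_of_measure_ne_zero hpos'
  have hp : (0:ℝ) < p := (hf0 s₀).trans_lt hs₀.1
  refine lintegral_strict_mono_of_ae_le_of_ae_lt_on (s := Ioo (p:ℝ) q)
    (antitone_weightPrimitive_measure_lt μ ω g).measurable.aemeasurable
    ((weightedLayer_mono μ ω hfg).trans_lt hgt.lt_top).ne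
    (Eventually.of_forall fun θ => weightPrimitive_mono ω
      (measure_mono fun s hs => lt_of_lt_of_le hs (hfg s))) ?_ ?_
  · rw [Measure.restrict_apply' measurableSet_Ioi,
      inter_eq_left.2 (Ioo_subset_Ioi_self.trans (Ioi_subset_Ioi hp.le))]
    simpa using hpq
  · refine Eventually.of_forall fun θ hθ => ?_
    have hgθ := measure_lt_ne_top_of_weightedLayer hωint hgt (hp.trans hθ.1)
    refine hω.weightPrimitive_lt hωpos ?_ hgθ
    have hle : {s | θ < f s} ⊆ {s | θ < g s} := fun s hs => lt_of_lt_of_le hs (hfg s)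
    have hdisj : Disjoint {s | f s < p ∧ q < g s} {s | θ < f s} :=
      disjoint_left.2 fun s h1 h2 => (h1.1.trans hθ.1).not_gt h2
    calc μ {s | θ < f s} < μ {s | θ < f s} + μ {s | f s < p ∧ q < g s} :=
          ENNReal.lt_add_right (ne_top_of_le_ne_top hgθ (measure_mono hle)) hpos'
      _ = μ ({s | f s < p ∧ q < g s} ∪ {s | θ < f s}) := by
          rw [measure_union hdisj (measurableSet_lt measurable_const hf), add_comm]
      _ ≤ _ := measure_mono (union_subset (fun s hs => hθ.2.trans hs.2) hle)

namespace IsOrliczFunction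

variable {φ : ℝ → ℝ}

theorem map_mul_le (hφ : IsOrliczFunction φ) {a : ℝ} (ha : 0 ≤ a) (ha1 : a ≤ 1) (u : ℝ) :
    φ (a * u) ≤ a * φ u := by
  have h := hφ.1.2 (mem_univ u) (mem_univ 0) ha (sub_nonneg.2 ha1) (by ring)
  simpa [hφ.2.2.1] using h

theorem map_abs (hφ : IsOrliczFunction φ) (u : ℝ) : φ |u| = φ u := by
  rcases abs_choice u with h | h <;> rw [h]
  exact hφ.2.1 u

theorem strictMonoOn (hφ : IsOrliczFunction φ) : StrictMonoOn φ (Ici 0) := by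
  intro u hu v _ huv
  have hu : 0 ≤ u := hu
  have hv : 0 < v := hu.trans_lt huv
  have h := hφ.map_mul_le (div_nonneg hu hv.le) ((div_le_one hv).2 huv.le) v
  rw [div_mul_cancel₀ _ hv.ne'] at h
  exact h.trans_lt (mul_lt_of_lt_one_left (hφ.2.2.2.1 v hv) ((div_lt_one hv).2 huv))

theorem lt_iff (hφ : IsOrliczFunction φ) (u v : ℝ) : φ u < φ v ↔ |u| < |v| := by
  rw [← hφ.map_abs u, ← hφ.map_abs v]
  exact hφ.strictMonoOn.lt_iff_lt (abs_nonneg u) (abs_nonneg v)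

theorem le_iff (hφ : IsOrliczFunction φ) (u v : ℝ) : φ u ≤ φ v ↔ |u| ≤ |v| := by
  rw [← not_lt, hφ.lt_iff, not_lt]

theorem continuous (hφ : IsOrliczFunction φ) : Continuous φ :=
  continuousOn_univ.1 (hφ.1.continuousOn isOpen_univ)

theorem exists_eq (hφ : IsOrliczFunction φ) {θ : ℝ} (hθ : 0 < θ) : ∃ u, 0 < u ∧ φ u = θ := by
  obtain ⟨v, hv, hv1⟩ :=
    ((hφ.2.2.2.2.2.2.eventually_ge_atTop θ).and (eventually_ge_atTop 1)).exists
  have hvpos : 0 < v := zero_lt_one.trans_le hv1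
  have hθv : θ ≤ φ v := by
    rw [le_div_iff₀ hvpos] at hv
    exact (le_mul_of_one_le_right hθ.le hv1).trans hv
  obtain ⟨u, hu, rfl⟩ := intermediate_value_Icc hvpos.le hφ.continuous.continuousOn
    ⟨hφ.2.2.1.le.trans hθ.le, hθv⟩
  refine ⟨u, lt_of_le_of_ne hu.1 ?_, rfl⟩
  rintro rfl
  exact hθ.ne' hφ.2.2.1

/-- Strictness of `φ(au) ≤ aφ(u)`, which comes from `φ(u)/u → 0` at `0`. -/
theorem map_mul_lt (hφ : IsOrliczFunction φ) {a : ℝ} (ha : 0 < a) (ha1 : a < 1) {u : ℝ}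
    (hu : u ≠ 0) : φ (a * u) < a * φ u := by
  wlog hu0 : 0 < u generalizing u
  · have h := this (neg_ne_zero.2 hu) (neg_pos.2 (lt_of_le_of_ne (not_lt.1 hu0) hu))
    rwa [mul_neg, hφ.2.1, hφ.2.1] at h
  refine lt_of_le_of_ne (hφ.map_mul_le ha.le ha1.le u) fun heq => ?_
  have hslope : 0 < φ u / u := div_pos (hφ.2.2.2.1 u hu0) hu0
  have hau : 0 < a * u := mul_pos ha hu0
  obtain ⟨v, hv, hv0, hvlt⟩ := ((hφ.2.2.2.2.2.1.eventually_lt_const hslope).and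
    (Ioo_mem_nhdsGT hau)).exists
  have hv0 : 0 < v := hv0
  rw [div_lt_div_iff₀ hv0 hu0] at hv
  have hd : 0 < u - v := by nlinarith
  have hconv := hφ.1.2 (mem_univ v) (mem_univ u)
    (div_nonneg (by nlinarith) hd.le : 0 ≤ (u - a * u) / (u - v))
    (div_nonneg (by linarith) hd.le : 0 ≤ (a * u - v) / (u - v)) (by field_simp; ring)
  have hpt : ((u - a * u) / (u - v)) • v + ((a * u - v) / (u - v)) • u = a * u := by
    simp only [smul_eq_mul]; field_simp; ring
  rw [hpt, heq, smul_eq_mul, smul_eq_mul, div_mul_eq_mul_div, div_mul_eq_mul_div, ← add_div,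
    le_div_iff₀ hd] at hconv
  have h1a : 0 < 1 - a := by linarith
  nlinarith [mul_lt_mul_of_pos_left hv h1a]

theorem map_le_of_abs_le (hφ : IsOrliczFunction φ) {a b : ℝ} (ha : 0 ≤ a) (hb : 0 ≤ b)
    (hab : a + b = 1) {u v w : ℝ} (hw : |w| ≤ a * |u| + b * |v|) :
    φ w ≤ a * φ u + b * φ v := by
  have h := hφ.1.2 (mem_univ |u|) (mem_univ |v|) ha hb hab
  simp only [smul_eq_mul, hφ.map_abs] at h
  exact ((hφ.le_iff _ _).2 (hw.trans (le_abs_self _))).trans h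

theorem map_lt_of_abs_lt (hφ : IsOrliczFunction φ) {a b : ℝ} (ha : 0 ≤ a) (hb : 0 ≤ b)
    (hab : a + b = 1) {u v w : ℝ} (hw : |w| < a * |u| + b * |v|) :
    φ w < a * φ u + b * φ v := by
  have h := hφ.1.2 (mem_univ |u|) (mem_univ |v|) ha hb hab
  simp only [smul_eq_mul, hφ.map_abs] at h
  exact ((hφ.lt_iff _ _).2 (hw.trans_le (le_abs_self _))).trans_le h

end IsOrliczFunction

theorem rearr_eq_zero {D : Set ℝ} {x : ℝ → ℝ}
    (h : ∀ u : ℝ, 0 < u → volume {s ∈ D | u < |x s|} = ⊤) (t : ℝ) : rearr D x t = 0 := by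
  have : {θ : ℝ | 0 < θ ∧ volume {s ∈ D | θ < |x s|} ≤ ENNReal.ofReal t} = ∅ := by
    refine eq_empty_of_forall_notMem fun θ hθ => ?_
    have h2 := hθ.2
    rw [h θ hθ.1, top_le_iff] at h2
    exact ENNReal.ofReal_ne_top h2
  rw [rearr, this, Real.sInf_empty]

theorem rearr_nonneg (D : Set ℝ) (x : ℝ → ℝ) (t : ℝ) : 0 ≤ rearr D x t :=
  Real.sInf_nonneg fun _ hθ => hθ.1.le

theorem IsOrliczFunction.olModular_eq_zero {φ : ℝ → ℝ} (hφ : IsOrliczFunction φ) (ω : ℝ → ℝ)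
    {D : Set ℝ} {x : ℝ → ℝ} (h : ∀ u : ℝ, 0 < u → volume {s ∈ D | u < |x s|} = ⊤) :
    olModular D φ ω x = 0 := by
  simp [olModular, rearr_eq_zero h, hφ.2.2.1]

theorem exists_measure_lt_abs_ne_top_const_mul {D : Set ℝ} {x : ℝ → ℝ} {c : ℝ} (hc : 0 < c)
    (h : ∃ u : ℝ, 0 < u ∧ volume {s ∈ D | u < |x s|} ≠ ⊤) :
    ∃ u : ℝ, 0 < u ∧ volume {s ∈ D | u < |c * x s|} ≠ ⊤ := by
  obtain ⟨u, hu, hfin⟩ := h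
  refine ⟨c * u, mul_pos hc hu, ?_⟩
  simpa [abs_mul, abs_of_pos hc, hc] using hfin

theorem IsOrliczFunction.exists_measure_lt_abs_ne_top {φ : ℝ → ℝ} (hφ : IsOrliczFunction φ)
    {ω : ℝ → ℝ} {D : Set ℝ} {x : ℝ → ℝ} (h : orliczNorm D φ ω x ≠ 0) :
    ∃ u : ℝ, 0 < u ∧ volume {s ∈ D | u < |x s|} ≠ ⊤ := by
  by_contra! hcon
  refine h (le_antisymm (le_of_forall_pos_le_add fun ε hε => ?_) zero_le)
  by_cases hεt : ε = ⊤
  · simp [hεt]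
  have hr : 0 < ε.toReal := ENNReal.toReal_pos hε.ne' hεt
  have hmod : olModular D φ ω (fun t => ε.toReal⁻¹ * x t) = 0 := by
    refine hφ.olModular_eq_zero ω fun u hu => ?_
    have hset := hcon (ε.toReal * u) (mul_pos hr hu)
    rw [← hset]
    congr 1
    ext s
    rw [mem_ofPred_eq, mem_ofPred_eq, abs_mul, abs_of_pos (inv_pos.2 hr), lt_inv_mul_iff₀ hr]
  refine (iInf₂_le ε.toReal⁻¹ (mem_Ioi.2 (inv_pos.2 hr))).trans ?_
  rw [hmod, add_zero, ENNReal.ofReal_inv_of_pos hr, ENNReal.ofReal_toReal hεt, one_div, inv_inv,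
    zero_add]

theorem nonempty_rearr_levels {D : Set ℝ} (hD : MeasurableSet D) {x : ℝ → ℝ} (hx : Measurable x)
    (hfin : ∃ u : ℝ, 0 < u ∧ volume {s ∈ D | u < |x s|} ≠ ⊤) {t : ℝ} (ht : 0 < t) :
    {θ : ℝ | 0 < θ ∧ volume {s ∈ D | θ < |x s|} ≤ ENNReal.ofReal t}.Nonempty := by
  obtain ⟨u, hu, hfin⟩ := hfin
  have hlim := tendsto_measure_iInter_atTop (μ := volume) (s := fun θ : ℝ => {s ∈ D | θ < |x s|})
    (fun θ => (hD.inter (measurableSet_lt measurable_const hx.abs)).nullMeasurableSet)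
    (fun _ _ h _ hs => ⟨hs.1, h.trans_lt hs.2⟩) ⟨u, hfin⟩
  have hempty : ⋂ θ : ℝ, {s ∈ D | θ < |x s|} = ∅ :=
    eq_empty_of_forall_notMem fun s hs => lt_irrefl _ (mem_iInter.1 hs |x s|).2
  rw [hempty, measure_empty] at hlim
  obtain ⟨θ, hθ, hθ0⟩ := ((hlim.eventually_lt_const (ENNReal.ofReal_pos.2 ht)).and
    (eventually_gt_atTop 0)).exists
  exact ⟨θ, hθ0, hθ.le⟩

theorem lt_rearr_iff {D : Set ℝ} (hD : MeasurableSet D) {x : ℝ → ℝ} (hx : Measurable x)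
    (hfin : ∃ u : ℝ, 0 < u ∧ volume {s ∈ D | u < |x s|} ≠ ⊤) {t : ℝ} (ht : 0 < t) {u : ℝ}
    (hu : 0 < u) :
    u < rearr D x t ↔ ENNReal.ofReal t < volume {s ∈ D | u < |x s|} := by
  constructor
  · intro h
    by_contra hle
    have hmem : u ∈ {θ : ℝ | 0 < θ ∧ volume {s ∈ D | θ < |x s|} ≤ ENNReal.ofReal t} :=
      ⟨hu, not_lt.1 hle⟩
    exact (csInf_le ⟨0, fun _ hθ => hθ.1.le⟩ hmem).not_gt h
  · intro h
    have hunion : {s ∈ D | u < |x s|} = ⋃ n : ℕ, {s ∈ D | u + 1 / ((n:ℝ) + 1) < |x s|} := by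
      ext s
      simp only [mem_iUnion, mem_ofPred_eq]
      constructor
      · rintro ⟨hs, hlt⟩
        obtain ⟨n, hn⟩ := exists_nat_one_div_lt (sub_pos.2 hlt)
        exact ⟨n, hs, by linarith⟩
      · rintro ⟨n, hs, hlt⟩
        exact ⟨hs, (lt_add_of_pos_right u Nat.one_div_pos_of_nat).trans hlt⟩
    have hmono : Monotone fun n : ℕ => {s ∈ D | u + 1 / ((n:ℝ) + 1) < |x s|} := by
      intro m n hmn s hs
      exact ⟨hs.1, (add_le_add_right (Nat.one_div_le_one_div hmn) u).trans_lt hs.2⟩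
    rw [hunion, hmono.measure_iUnion, lt_iSup_iff] at h
    obtain ⟨n, hn⟩ := h
    refine (lt_add_of_pos_right u (Nat.one_div_pos_of_nat (n := n))).trans_le
      (le_csInf (nonempty_rearr_levels hD hx hfin ht) fun θ hθ => ?_)
    by_contra hlt
    refine (hn.trans_le ((measure_mono fun s hs => ?_).trans hθ.2)).false
    exact ⟨hs.1, (not_le.1 hlt).trans hs.2⟩

theorem antitoneOn_rearr {D : Set ℝ} (hD : MeasurableSet D) {x : ℝ → ℝ} (hx : Measurable x)
    (hfin : ∃ u : ℝ, 0 < u ∧ volume {s ∈ D | u < |x s|} ≠ ⊤) :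
    AntitoneOn (rearr D x) (Ioi 0) := fun _ hs _ _ hst =>
  csInf_le_csInf ⟨0, fun _ hθ => hθ.1.le⟩ (nonempty_rearr_levels hD hx hfin hs)
    fun _ hθ => ⟨hθ.1, hθ.2.trans (ENNReal.ofReal_le_ofReal hst)⟩

theorem IsOrliczFunction.olModular_eq {φ ω : ℝ → ℝ} (hφ : IsOrliczFunction φ)
    (hω : IsWeight (Ici 0) ω) {x : ℝ → ℝ} (hx : Measurable x)
    (hfin : ∃ u : ℝ, 0 < u ∧ volume {s ∈ Ici (0:ℝ) | u < |x s|} ≠ ⊤) :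
    olModular (Ici 0) φ ω x =
      weightedLayer (volume.restrict (Ici 0)) ω (fun s => φ (x s)) := by
  have hrearr : AEMeasurable (fun t => φ (rearr (Ici 0) x t)) (volume.restrict (Ici 0)) := by
    rw [← restrict_Ioi_eq_restrict_Ici]
    exact hφ.continuous.measurable.comp_aemeasurable
      (aemeasurable_restrict_of_antitoneOn measurableSet_Ioi
        (antitoneOn_rearr measurableSet_Ici hx hfin))
  have hωm := hω.aemeasurable.ennreal_ofReal
  set ν := (volume.restrict (Ici (0:ℝ))).withDensity fun t => ENNReal.ofReal (ω t) with hν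
  have hac : ν ≪ volume.restrict (Ici 0) := withDensity_absolutelyContinuous _ _
  have hmod : olModular (Ici 0) φ ω x = ∫⁻ t, ENNReal.ofReal (φ (rearr (Ici 0) x t)) ∂ν := by
    rw [hν, lintegral_withDensity_eq_lintegral_mul₀ hωm hrearr.ennreal_ofReal]
    refine lintegral_congr fun t => ?_
    rw [ENNReal.ofReal_mul (hφ.2.2.2.2.1 _), mul_comm, Pi.mul_apply]
  rw [hmod, lintegral_eq_lintegral_meas_lt ν (Eventually.of_forall fun t => hφ.2.2.2.2.1 _)
    (hrearr.mono_ac hac), weightedLayer]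
  refine setLIntegral_congr_fun measurableSet_Ioi fun θ hθ => ?_
  obtain ⟨u, hu, rfl⟩ := hφ.exists_eq hθ
  have hlevel : volume.restrict (Ici 0) {s | φ u < φ (x s)} =
      volume {s ∈ Ici (0:ℝ) | u < |x s|} := by
    rw [Measure.restrict_apply' measurableSet_Ici]
    congr 1
    ext s
    simp only [hφ.lt_iff, abs_of_pos hu]
    exact and_comm
  have hae : {t | φ u < φ (rearr (Ici 0) x t)} =ᵐ[ν]
      domSet (volume.restrict (Ici 0) {s | φ u < φ (x s)}) := by
    refine hac.ae_le ?_
    rw [← restrict_Ioi_eq_restrict_Ici]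
    refine ae_restrict_of_forall_mem measurableSet_Ioi fun t (ht : 0 < t) => propext ?_
    rw [restrict_Ioi_eq_restrict_Ici, hlevel]
    change φ u < φ (rearr (Ici 0) x t) ↔ 0 ≤ t ∧ _
    rw [hφ.lt_iff, abs_of_pos hu, abs_of_nonneg (rearr_nonneg _ _ _),
      lt_rearr_iff measurableSet_Ici hx hfin ht hu, and_iff_right ht.le]
  rw [measure_congr hae, hν, withDensity_apply _ (measurableSet_domSet _),
    Measure.restrict_restrict (measurableSet_domSet _),
    inter_eq_left.2 fun t ht => ht.1, weightPrimitive]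

theorem IsOrliczFunction.olModular_le {φ ω : ℝ → ℝ} (hφ : IsOrliczFunction φ)
    (hω : IsWeight (Ici 0) ω) {x : ℝ → ℝ} (hx : Measurable x) :
    olModular (Ici 0) φ ω x ≤
      weightedLayer (volume.restrict (Ici 0)) ω (fun s => φ (x s)) := by
  by_cases hfin : ∃ u : ℝ, 0 < u ∧ volume {s ∈ Ici (0:ℝ) | u < |x s|} ≠ ⊤
  · exact (hφ.olModular_eq hω hx hfin).le
  · push Not at hfin
    simp [hφ.olModular_eq_zero ω hfin]

/-- For `a + b = 1`, the modular of `z` is strictly below `aρ(x) + bρ(y)` as soon as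
`φ(z) ≤ aφ(x) + bφ(y)` pointwise, with strict inequality on a set of positive measure. -/
theorem IsOrliczFunction.olModular_lt {φ ω : ℝ → ℝ} (hφ : IsOrliczFunction φ)
    (hω : IsWeight (Ici 0) ω) (hωpos : ∀ t ∈ Ici (0:ℝ), 0 < ω t)
    (hωint : (∫⁻ t in Ici (0:ℝ), ENNReal.ofReal (ω t)) = ⊤) {x y z : ℝ → ℝ}
    (hx : Measurable x) (hy : Measurable y) (hz : Measurable z)
    (hxfin : ∃ u : ℝ, 0 < u ∧ volume {s ∈ Ici (0:ℝ) | u < |x s|} ≠ ⊤)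
    (hyfin : ∃ u : ℝ, 0 < u ∧ volume {s ∈ Ici (0:ℝ) | u < |y s|} ≠ ⊤)
    (hxt : olModular (Ici 0) φ ω x ≠ ⊤) (hyt : olModular (Ici 0) φ ω y ≠ ⊤)
    {a b : ℝ} (ha : 0 < a) (hb : 0 < b) (hle : ∀ s, φ (z s) ≤ a * φ (x s) + b * φ (y s))
    (hpos : volume {s ∈ Ici (0:ℝ) | φ (z s) < a * φ (x s) + b * φ (y s)} ≠ 0) :
    olModular (Ici 0) φ ω z <
      ENNReal.ofReal a * olModular (Ici 0) φ ω x + ENNReal.ofReal b * olModular (Ici 0) φ ω y := by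
  have hφm := hφ.continuous.measurable
  have hconv := hω.weightedLayer_convex (volume.restrict (Ici 0)) (hφm.comp hx) (hφm.comp hy) ha hb
  have hx' := hφ.olModular_eq hω hx hxfin
  have hy' := hφ.olModular_eq hω hy hyfin
  simp only [Function.comp_def] at hconv
  rw [← hx', ← hy'] at hconv
  refine (hφ.olModular_le hω hz).trans_lt (lt_of_lt_of_le ?_ hconv)
  refine hω.weightedLayer_lt hωpos hωint (hφm.comp hz) (fun s => hφ.2.2.2.2.1 _) hle ?_
    (ne_top_of_le_ne_top ?_ hconv)
  · rw [Measure.restrict_apply' measurableSet_Ici, inter_comm]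
    exact hpos
  · exact ENNReal.add_ne_top.2 ⟨ENNReal.mul_ne_top ENNReal.ofReal_ne_top hxt,
      ENNReal.mul_ne_top ENNReal.ofReal_ne_top hyt⟩

theorem olModular_eq_of_mem_KSet {D : Set ℝ} {φ ω x : ℝ → ℝ} {k : ℝ}
    (hn : orliczNorm D φ ω x = 1) (hk : k ∈ KSet D φ ω x) :
    1 ≤ k ∧ olModular D φ ω (fun t => k * x t) = ENNReal.ofReal (k - 1) := by
  obtain ⟨hk0, h⟩ := hk
  have hk' : ENNReal.ofReal k ≠ 0 := by simpa using hk0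
  rw [hn, eq_comm, ENNReal.div_eq_one_iff hk' ENNReal.ofReal_ne_top] at h
  refine ⟨?_, ?_⟩
  · rw [← ENNReal.one_le_ofReal, ← h]
    exact le_self_add
  · rw [ENNReal.ofReal_sub k zero_le_one, ENNReal.ofReal_one, ← h,
      ENNReal.add_sub_cancel_left ENNReal.one_ne_top]

theorem orliczNorm_lt_one {D : Set ℝ} {φ ω x : ℝ → ℝ} {k : ℝ}
    (h : olModular D φ ω (fun t => k * x t) < ENNReal.ofReal (k - 1)) :
    orliczNorm D φ ω x < 1 := by
  have hk1 : 0 < k - 1 := ENNReal.ofReal_pos.1 (pos_of_gt h)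
  have hk : 0 < k := by linarith
  refine (iInf₂_le k (mem_Ioi.2 hk)).trans_lt ?_
  rw [ENNReal.div_lt_iff (Or.inl (by simpa using hk)) (Or.inl ENNReal.ofReal_ne_top), one_mul]
  calc _ < 1 + ENNReal.ofReal (k - 1) := ENNReal.add_lt_add_left ENNReal.one_ne_top h
    _ = _ := by
      rw [← ENNReal.ofReal_one, ← ENNReal.ofReal_add zero_le_one hk1.le, add_sub_cancel]

theorem IsOrliczFunction.olModular_lt_of_sphere {φ ω : ℝ → ℝ} (hφ : IsOrliczFunction φ)
    (hω : IsWeight (Ici 0) ω) (hωpos : ∀ t ∈ Ici (0:ℝ), 0 < ω t)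
    (hωint : (∫⁻ t in Ici (0:ℝ), ENNReal.ofReal (ω t)) = ⊤) {x y w : ℝ → ℝ}
    (hx : Measurable x) (hy : Measurable y) (hw : Measurable w)
    (hxn : orliczNorm (Ici 0) φ ω x = 1) (hyn : orliczNorm (Ici 0) φ ω y = 1)
    {k₁ k₂ : ℝ} (hk₁ : k₁ ∈ KSet (Ici 0) φ ω x) (hk₂ : k₂ ∈ KSet (Ici 0) φ ω y)
    (hle : ∀ s, φ (2 * k₁ * k₂ / (k₁ + k₂) * w s / 2) ≤
      k₂ / (k₁ + k₂) * φ (k₁ * x s) + k₁ / (k₁ + k₂) * φ (k₂ * y s))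
    (hpos : volume {s ∈ Ici (0:ℝ) | φ (2 * k₁ * k₂ / (k₁ + k₂) * w s / 2) <
      k₂ / (k₁ + k₂) * φ (k₁ * x s) + k₁ / (k₁ + k₂) * φ (k₂ * y s)} ≠ 0) :
    olModular (Ici 0) φ ω (fun t => 2 * k₁ * k₂ / (k₁ + k₂) * w t / 2) <
        ENNReal.ofReal (2 * k₁ * k₂ / (k₁ + k₂) - 1) ∧
      orliczNorm (Ici 0) φ ω (fun t => w t / 2) < 1 := by
  have hk₁0 : 0 < k₁ := hk₁.1
  have hk₂0 : 0 < k₂ := hk₂.1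
  obtain ⟨hk₁1, hρ₁⟩ := olModular_eq_of_mem_KSet hxn hk₁
  obtain ⟨hk₂1, hρ₂⟩ := olModular_eq_of_mem_KSet hyn hk₂
  have ha : 0 < k₂ / (k₁ + k₂) := by positivity
  have hb : 0 < k₁ / (k₁ + k₂) := by positivity
  have h := hφ.olModular_lt hω hωpos hωint (hx.const_mul k₁) (hy.const_mul k₂)
    ((hw.const_mul (2 * k₁ * k₂ / (k₁ + k₂))).div_const 2)
    (exists_measure_lt_abs_ne_top_const_mul hk₁0
      (hφ.exists_measure_lt_abs_ne_top (hxn.trans_ne one_ne_zero)))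
    (exists_measure_lt_abs_ne_top_const_mul hk₂0
      (hφ.exists_measure_lt_abs_ne_top (hyn.trans_ne one_ne_zero)))
    (hρ₁.trans_ne ENNReal.ofReal_ne_top) (hρ₂.trans_ne ENNReal.ofReal_ne_top) ha hb hle hpos
  rw [hρ₁, hρ₂, ← ENNReal.ofReal_mul ha.le, ← ENNReal.ofReal_mul hb.le,
    ← ENNReal.ofReal_add (mul_nonneg ha.le (sub_nonneg.2 hk₁1))
      (mul_nonneg hb.le (sub_nonneg.2 hk₂1)),
    show k₂ / (k₁ + k₂) * (k₁ - 1) + k₁ / (k₁ + k₂) * (k₂ - 1) =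
      2 * k₁ * k₂ / (k₁ + k₂) - 1 by field_simp; ring] at h
  refine ⟨h, orliczNorm_lt_one (k := 2 * k₁ * k₂ / (k₁ + k₂)) ?_⟩
  simpa only [mul_div_assoc] using h

/-- Key modular estimates in the sufficiency part of the
non-squareness theorem for `Λ°_{φ,ω}[0,∞)`. -/
theorem modular_lt_of_sphere_points
    (φ ω : ℝ → ℝ) (hφ : IsOrliczFunction φ) (hω : IsWeight (Set.Ici 0) ω)
    (hωpos : ∀ t ∈ Set.Ici (0:ℝ), 0 < ω t)
    (hωint : (∫⁻ t in Set.Ici (0:ℝ), ENNReal.ofReal (ω t)) = ⊤)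
    (x y : ℝ → ℝ) (hx : MemOL (Set.Ici 0) φ ω x) (hy : MemOL (Set.Ici 0) φ ω y)
    (hxn : orliczNorm (Set.Ici 0) φ ω x = 1) (hyn : orliczNorm (Set.Ici 0) φ ω y = 1)
    (k₁ k₂ : ℝ) (hk₁ : k₁ ∈ KSet (Set.Ici 0) φ ω x) (hk₂ : k₂ ∈ KSet (Set.Ici 0) φ ω y)
    (k : ℝ) (hk : k = 2 * k₁ * k₂ / (k₁ + k₂)) :
    (0 < volume {t ∈ Set.Ici (0:ℝ) | 0 < x t * y t} →
      olModular (Set.Ici 0) φ ω (fun t => k * (x t - y t) / 2) <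
          ENNReal.ofReal (k - 1) ∧
      orliczNorm (Set.Ici 0) φ ω (fun t => (x t - y t) / 2) < 1) ∧
    (0 < volume {t ∈ Set.Ici (0:ℝ) |
        x t * y t < 0 ∨ (x t * y t = 0 ∧ 0 < max |x t| |y t|)} →
      olModular (Set.Ici 0) φ ω (fun t => k * (x t + y t) / 2) <
          ENNReal.ofReal (k - 1) ∧
      orliczNorm (Set.Ici 0) φ ω (fun t => (x t + y t) / 2) < 1) := by
  subst hk
  have hk₁0 : 0 < k₁ := hk₁.1
  have hk₂0 : 0 < k₂ := hk₂.1
  have ha : 0 < k₂ / (k₁ + k₂) := by positivity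
  have hb : 0 < k₁ / (k₁ + k₂) := by positivity
  have hab : k₂ / (k₁ + k₂) + k₁ / (k₁ + k₂) = 1 := by field_simp; ring
  have hc : 0 < k₁ * k₂ / (k₁ + k₂) := by positivity
  have hfac (u : ℝ) : |2 * k₁ * k₂ / (k₁ + k₂) * u / 2| = k₁ * k₂ / (k₁ + k₂) * |u| := by
    rw [show 2 * k₁ * k₂ / (k₁ + k₂) * u / 2 = k₁ * k₂ / (k₁ + k₂) * u by ring, abs_mul,
      abs_of_pos hc]
  have hsum (u v : ℝ) : k₂ / (k₁ + k₂) * |k₁ * u| + k₁ / (k₁ + k₂) * |k₂ * v| =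
      k₁ * k₂ / (k₁ + k₂) * (|u| + |v|) := by
    rw [abs_mul, abs_mul, abs_of_pos hk₁0, abs_of_pos hk₂0]
    ring
  have hle {u v w : ℝ} (h : |w| ≤ |u| + |v|) : φ (2 * k₁ * k₂ / (k₁ + k₂) * w / 2) ≤
      k₂ / (k₁ + k₂) * φ (k₁ * u) + k₁ / (k₁ + k₂) * φ (k₂ * v) :=
    hφ.map_le_of_abs_le ha.le hb.le hab (by rw [hfac, hsum]; gcongr)
  have hlt {u v w : ℝ} (h : |w| < |u| + |v|) : φ (2 * k₁ * k₂ / (k₁ + k₂) * w / 2) <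
      k₂ / (k₁ + k₂) * φ (k₁ * u) + k₁ / (k₁ + k₂) * φ (k₂ * v) :=
    hφ.map_lt_of_abs_lt ha.le hb.le hab (by rw [hfac, hsum]; gcongr)
  constructor
  · intro hpos
    refine hφ.olModular_lt_of_sphere (w := fun s => x s - y s) hω hωpos hωint hx.1 hy.1
      (hx.1.sub hy.1) hxn hyn hk₁ hk₂ (fun s => hle (abs_sub _ _))
      (ne_of_gt (hpos.trans_le (measure_mono ?_)))
    rintro s ⟨hs, hxy⟩
    refine ⟨hs, hlt ?_⟩
    rcases pos_and_pos_or_neg_and_neg_of_mul_pos hxy with ⟨h1, h2⟩ | ⟨h1, h2⟩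
    · rw [abs_of_pos h1, abs_of_pos h2, abs_lt]
      constructor <;> linarith
    · rw [abs_of_neg h1, abs_of_neg h2, abs_lt]
      constructor <;> linarith
  · intro hpos
    refine hφ.olModular_lt_of_sphere (w := fun s => x s + y s) hω hωpos hωint hx.1 hy.1
      (hx.1.add hy.1) hxn hyn hk₁ hk₂ (fun s => hle (abs_add_le _ _))
      (ne_of_gt (hpos.trans_le (measure_mono ?_)))
    rintro s ⟨hs, hxy | ⟨hxy, hmax⟩⟩
    · refine ⟨hs, hlt ?_⟩
      rcases mul_neg_iff.1 hxy with ⟨h1, h2⟩ | ⟨h1, h2⟩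
      · rw [abs_of_pos h1, abs_of_neg h2, abs_lt]
        constructor <;> linarith
      · rw [abs_of_neg h1, abs_of_pos h2, abs_lt]
        constructor <;> linarith
    · refine ⟨hs, ?_⟩
      rcases mul_eq_zero.1 hxy with h | h
      · have hy0 : y s ≠ 0 := by simpa [h] using hmax
        have := hφ.map_mul_lt hb (by linarith) (mul_ne_zero hk₂0.ne' hy0)
        rw [h, zero_add, mul_zero, hφ.2.2.1, mul_zero, zero_add]
        convert this using 2
        ring
      · have hx0 : x s ≠ 0 := by simpa [h] using hmax
        have := hφ.map_mul_lt ha (by linarith) (mul_ne_zero hk₁0.ne' hx0)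
        rw [h, add_zero, mul_zero, hφ.2.2.1, mul_zero, add_zero]
        convert this using 2
        ring
end
end

section
/- Let 1/2 < α < 1 where α = sup{t ≥ 0 : ω(t) > 0}, let x, y be in the unit sphere of Λ°_{φ,ω}[0,1), let k₁ ∈ K(x), k₂ ∈ K(y), k = 2k₁k₂/(k₁+k₂), and suppose μ{t ∈ [0,1) : max{|x(t)|,|y(t)|} > 0} > α. Then there exists t ∈ [0,α) such that φ(((k(x+y)/2))*(t)) < ((k₂/(k₁+k₂))·φ(k₁x) + (k₁/(k₁+k₂))·φ(k₂y))*(t) or φ(((k(x−y)/2))*(t)) < ((k₂/(k₁+k₂))·φ(k₁x) + (k₁/(k₁+k₂))·φ(k₂y))*(t). -/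
open MeasureTheory Set Filter Topology
open scoped ENNReal

noncomputable section

/-- If `φ` is an Orlicz function then `φ (r * p) < r * φ p` for `0 < r < 1` and `p ≠ 0`. -/
theorem IsOrliczFunction.map_mul_lt_s15 {φ : ℝ → ℝ} (hφ : IsOrliczFunction φ) {r p : ℝ}
    (hr : 0 < r) (hr1 : r < 1) (hp : 0 < p) : φ (r * p) < r * φ p := by
  obtain ⟨hc, -, h0, hpos, -, hlim, -⟩ := hφ
  by_contra! hle
  have hpp := hpos p hp
  have hev := (hlim.eventually (gt_mem_nhds (div_pos hpp hp))).and
    (Ioo_mem_nhdsGT (mul_pos hr hp))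
  obtain ⟨u, hu1, hu0, hu2⟩ := hev.exists
  have hup : u < p := by nlinarith
  have hd : 0 < p - u := sub_pos.2 hup
  have hcv := hc.2 (mem_univ u) (mem_univ p)
    (show 0 ≤ (p - r * p) / (p - u) from div_nonneg (by nlinarith) hd.le)
    (show 0 ≤ (r * p - u) / (p - u) from div_nonneg (by linarith) hd.le)
    (by field_simp; ring)
  have he : ((p - r * p) / (p - u)) • u + ((r * p - u) / (p - u)) • p = r * p := by
    simp only [smul_eq_mul]; field_simp; ring
  rw [he] at hcv
  have h1 := hle.trans hcv
  simp only [smul_eq_mul] at h1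
  rw [div_mul_eq_mul_div, div_mul_eq_mul_div, ← add_div, le_div_iff₀ hd] at h1
  rw [div_lt_div_iff₀ hu0 hp] at hu1
  have h2 : (1 - r) * (φ u * p) < (1 - r) * (φ p * u) :=
    mul_lt_mul_of_pos_left hu1 (by linarith)
  nlinarith

theorem IsOrliczFunction.lt_of_lt {φ : ℝ → ℝ} (hφ : IsOrliczFunction φ) {u v : ℝ}
    (hu : 0 ≤ u) (huv : u < v) : φ u < φ v := by
  have hv := hu.trans_lt huv
  rcases hu.eq_or_lt with rfl | hu
  · rw [hφ.2.2.1]; exact hφ.2.2.2.1 v hv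
  · have h := hφ.map_mul_lt_s15 (div_pos hu hv) ((div_lt_one hv).2 huv) hv
    rw [div_mul_cancel₀ _ hv.ne'] at h
    have h1 : u / v * φ v < 1 * φ v :=
      mul_lt_mul_of_pos_right ((div_lt_one hv).2 huv) (hφ.2.2.2.1 v hv)
    linarith

theorem IsOrliczFunction.map_abs_s15 {φ : ℝ → ℝ} (hφ : IsOrliczFunction φ) (u : ℝ) :
    φ |u| = φ u := by
  rcases abs_choice u with h | h <;> rw [h]
  exact hφ.2.1 u

theorem IsOrliczFunction.lt_iff_abs {φ : ℝ → ℝ} (hφ : IsOrliczFunction φ) {u v : ℝ}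
    (hu : 0 ≤ u) : φ u < φ v ↔ u < |v| := by
  rw [← hφ.map_abs_s15 v]
  refine ⟨fun h => ?_, hφ.lt_of_lt hu⟩
  by_contra! h1
  rcases h1.eq_or_lt with h2 | h2
  · rw [h2] at h; exact lt_irrefl _ h
  · exact lt_asymm h (hφ.lt_of_lt (abs_nonneg v) h2)

theorem IsOrliczFunction.continuous_s15 {φ : ℝ → ℝ} (hφ : IsOrliczFunction φ) : Continuous φ :=
  continuousOn_univ.1 (hφ.1.continuousOn isOpen_univ)

theorem IsOrliczFunction.exists_eq_s15 {φ : ℝ → ℝ} (hφ : IsOrliczFunction φ) {θ : ℝ}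
    (hθ : 0 ≤ θ) : ∃ η, 0 ≤ η ∧ φ η = θ := by
  obtain ⟨u, hu, hu1⟩ := ((hφ.2.2.2.2.2.2.eventually_ge_atTop θ).and
    (eventually_ge_atTop (1 : ℝ))).exists
  have hu0 : 0 < u := by linarith
  rw [le_div_iff₀ hu0] at hu
  have h := intermediate_value_Icc hu0.le hφ.continuous_s15.continuousOn
  rw [hφ.2.2.1] at h
  obtain ⟨η, hη, he⟩ := h ⟨hθ, by nlinarith⟩
  exact ⟨η, hη.1, he⟩

theorem IsOrliczFunction.convex_add_le {φ : ℝ → ℝ} (hφ : IsOrliczFunction φ) {a b : ℝ}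
    (ha : 0 < a) (hb : 0 < b) (hab : a + b = 1) (p q : ℝ) :
    φ (a * p + b * q) ≤ a * φ p + b * φ q := by
  simpa using hφ.1.2 (mem_univ p) (mem_univ q) ha.le hb.le hab

theorem IsOrliczFunction.convex_sub_le {φ : ℝ → ℝ} (hφ : IsOrliczFunction φ) {a b : ℝ}
    (ha : 0 < a) (hb : 0 < b) (hab : a + b = 1) (p q : ℝ) :
    φ (a * p - b * q) ≤ a * φ p + b * φ q := by
  simpa [hφ.2.1, sub_eq_add_neg] using hφ.convex_add_le ha hb hab p (-q)

/-- Unless both points vanish, one of the two convexity inequalities for `p, q` and for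
`p, -q` is strict. -/
theorem IsOrliczFunction.convex_lt {φ : ℝ → ℝ} (hφ : IsOrliczFunction φ) {a b : ℝ}
    (ha : 0 < a) (hb : 0 < b) (hab : a + b = 1) {p q : ℝ} (hpq : p ≠ 0 ∨ q ≠ 0) :
    φ (a * p + b * q) < a * φ p + b * φ q ∨ φ (a * p - b * q) < a * φ p + b * φ q := by
  have hz : ∀ {r s : ℝ}, 0 < r → r < 1 → s ≠ 0 → φ (r * s) < r * φ s := by
    intro r s hr hr1 hs
    have h := hφ.map_mul_lt_s15 hr hr1 (abs_pos.2 hs)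
    rwa [hφ.map_abs_s15 s, ← abs_of_pos hr, ← abs_mul, hφ.map_abs_s15, abs_of_pos hr] at h
  by_cases hp : p = 0
  · left
    have := hz hb (by linarith) (hpq.resolve_left (not_not.2 hp))
    simpa [hp, hφ.2.2.1] using this
  by_cases hq : q = 0
  · left
    have := hz ha (by linarith) hp
    simpa [hq, hφ.2.2.1] using this
  have hle := hφ.convex_add_le ha hb hab |p| |q|
  rw [hφ.map_abs_s15 p, hφ.map_abs_s15 q] at hle
  have key : ∀ w : ℝ, |w| < a * |p| + b * |q| → φ w < a * φ p + b * φ q := fun w hw => by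
    have h := hφ.lt_of_lt (abs_nonneg w) hw
    rw [hφ.map_abs_s15] at h
    exact h.trans_le hle
  rcases lt_or_gt_of_ne hp with hp | hp <;> rcases lt_or_gt_of_ne hq with hq | hq
  · right; apply key; rw [abs_of_neg hp, abs_of_neg hq, abs_lt]
    constructor <;> nlinarith [mul_pos_of_neg_of_neg hp hq, mul_neg_of_pos_of_neg ha hp,
      mul_neg_of_pos_of_neg hb hq]
  · left; apply key; rw [abs_of_neg hp, abs_of_pos hq, abs_lt]
    constructor <;> nlinarith [mul_neg_of_pos_of_neg ha hp, mul_pos hb hq]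
  · left; apply key; rw [abs_of_pos hp, abs_of_neg hq, abs_lt]
    constructor <;> nlinarith [mul_pos ha hp, mul_neg_of_pos_of_neg hb hq]
  · right; apply key; rw [abs_of_pos hp, abs_of_pos hq, abs_lt]
    constructor <;> nlinarith [mul_pos ha hp, mul_pos hb hq]

/-- The decreasing rearrangement at `t > 0` is at most `θ` exactly when the distribution
function at `θ` is at most `t`. -/
theorem rearr_le_iff {D : Set ℝ} (hD : MeasurableSet D) (hDf : volume D ≠ ⊤) {g : ℝ → ℝ}
    (hg : Measurable g) {t θ : ℝ} (ht : 0 < t) (hθ : 0 ≤ θ) :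
    rearr D g t ≤ θ ↔ volume {s ∈ D | θ < |g s|} ≤ ENNReal.ofReal t := by
  have hbdd : BddBelow {θ : ℝ | 0 < θ ∧ volume {s ∈ D | θ < |g s|} ≤ ENNReal.ofReal t} :=
    ⟨0, fun _ h => h.1.le⟩
  constructor
  · intro h
    have hne : {θ : ℝ | 0 < θ ∧ volume {s ∈ D | θ < |g s|} ≤ ENNReal.ofReal t}.Nonempty := by
      have hlim : Tendsto (fun n : ℕ => volume {s ∈ D | (n : ℝ) < |g s|}) atTop
          (𝓝 (volume (⋂ n : ℕ, {s ∈ D | (n : ℝ) < |g s|}))) := by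
        refine tendsto_measure_iInter_atTop (fun n => ?_) ?_
          ⟨0, measure_ne_top_of_subset (fun s hs => hs.1) hDf⟩
        · exact (hD.inter (measurableSet_lt measurable_const hg.norm)).nullMeasurableSet
        · intro m n hmn s hs
          exact ⟨hs.1, lt_of_le_of_lt (Nat.cast_le.2 hmn) hs.2⟩
      have he : (⋂ n : ℕ, {s ∈ D | (n : ℝ) < |g s|}) = ∅ := by
        refine eq_empty_of_forall_notMem fun s hs => ?_
        obtain ⟨n, hn⟩ := exists_nat_ge |g s|
        exact absurd (mem_iInter.1 hs n).2 hn.not_gt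
      rw [he, measure_empty] at hlim
      obtain ⟨n, hn, hn1⟩ := ((hlim.eventually (gt_mem_nhds (ENNReal.ofReal_pos.2 ht))).and
        (eventually_ge_atTop 1)).exists
      exact ⟨n, Nat.cast_pos.2 hn1, hn.le⟩
    have hU : {s ∈ D | θ < |g s|} = ⋃ n : ℕ, {s ∈ D | θ + 1 / ((n : ℝ) + 1) < |g s|} := by
      ext s
      simp only [mem_ofPred_eq, mem_iUnion]
      constructor
      · rintro ⟨hs, h1⟩
        obtain ⟨n, hn⟩ := exists_nat_one_div_lt (sub_pos.2 h1)
        exact ⟨n, hs, by linarith⟩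
      · rintro ⟨n, hs, h1⟩
        have : (0 : ℝ) < 1 / ((n : ℝ) + 1) := by positivity
        exact ⟨hs, by linarith⟩
    rw [hU, Monotone.measure_iUnion]
    · refine iSup_le fun n => ?_
      have hn : (0 : ℝ) < 1 / ((n : ℝ) + 1) := by positivity
      obtain ⟨η, hη, hlt⟩ := exists_lt_of_csInf_lt hne (lt_of_le_of_lt h (lt_add_of_pos_right θ hn))
      exact (measure_mono (t := {s ∈ D | η < |g s|})
        fun s hs => ⟨hs.1, hlt.trans hs.2⟩).trans hη.2
    · intro m n hmn s hs
      refine ⟨hs.1, lt_of_le_of_lt ?_ hs.2⟩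
      have := Nat.one_div_le_one_div (α := ℝ) hmn
      linarith
  · intro h
    refine le_of_forall_gt_imp_ge_of_dense fun η hη => csInf_le hbdd ⟨hθ.trans_lt hη, ?_⟩
    exact (measure_mono (t := {s ∈ D | θ < |g s|})
      fun s hs => ⟨hs.1, hη.trans hs.2⟩).trans h

/-- If `z` is rearranged below `φ (f*)` on `(0, α)` then, wherever the distribution function
of `φ ∘ f` is below `α`, it dominates that of `z`. -/
theorem IsOrliczFunction.measure_le_of_rearr_le {φ : ℝ → ℝ} (hφ : IsOrliczFunction φ)
    {D : Set ℝ} (hD : MeasurableSet D) (hDf : volume D ≠ ⊤) {f z : ℝ → ℝ}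
    (hf : Measurable f) (hz : Measurable z) {α : ℝ}
    (h : ∀ t, 0 < t → t < α → rearr D z t ≤ φ (rearr D f t)) {θ : ℝ} (hθ : 0 ≤ θ)
    (hlt : volume.restrict D {s | θ < φ (f s)} < ENNReal.ofReal α) :
    volume.restrict D {s | θ < |z s|} ≤ volume.restrict D {s | θ < φ (f s)} := by
  have hR : ∀ p : ℝ → Prop, volume.restrict D {s | p s} = volume {s ∈ D | p s} := fun p => by
    rw [Measure.restrict_apply' hD, inter_comm]; rfl
  obtain ⟨η, hη, rfl⟩ := hφ.exists_eq_s15 hθ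
  simp only [hR, hφ.lt_iff_abs hη] at hlt ⊢
  refine le_of_forall_gt_imp_ge_of_dense fun b hb => ?_
  obtain ⟨c, hc1, hc2⟩ := exists_between (lt_min hb hlt)
  have hct : c ≠ ⊤ := (hc2.trans_le (min_le_right _ _)).ne_top
  have hc : ENNReal.ofReal c.toReal = c := ENNReal.ofReal_toReal hct
  have hc0 : 0 < c.toReal := ENNReal.toReal_pos (pos_of_gt hc1).ne' hct
  have hcα : c.toReal < α := by
    have := hc2.trans_le (min_le_right _ _)
    rw [← hc] at this
    exact ((ENNReal.ofReal_lt_ofReal_iff_of_nonneg hc0.le).1 this)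
  have h1 : rearr D f c.toReal ≤ η :=
    (rearr_le_iff hD hDf hf hc0 hη).2 (by rw [hc]; exact hc1.le)
  have h0 : 0 ≤ rearr D f c.toReal := Real.sInf_nonneg fun _ hx => hx.1.le
  have h2 : φ (rearr D f c.toReal) ≤ φ η := by
    rcases h1.eq_or_lt with h1 | h1
    · rw [h1]
    · exact (hφ.lt_of_lt h0 h1).le
  have h3 := (rearr_le_iff hD hDf hz hc0 hθ).1 ((h _ hc0 hcα).trans h2)
  rw [hc] at h3
  exact h3.trans (hc2.trans_le (min_le_left _ _)).le

/-- If `u ≤ z` and the distribution functions of `u` and `z` agree at levels above `c`, then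
`u = z` almost everywhere on `{z > c}`. -/
theorem measure_lt_and_lt_eq_zero {X : Type*} [MeasurableSpace X] {μ : Measure X}
    [IsFiniteMeasure μ] {u z : X → ℝ} (hu : Measurable u) (huz : ∀ s, u s ≤ z s) {c : ℝ}
    (h : ∀ θ, c < θ → μ {s | θ < z s} ≤ μ {s | θ < u s}) :
    μ {s | c < z s ∧ u s < z s} = 0 := by
  have hsub : {s | c < z s ∧ u s < z s} ⊆
      ⋃ q : {q : ℚ // c < q}, {s | (q : ℝ) < z s} \ {s | (q : ℝ) < u s} := by
    rintro s ⟨h1, h2⟩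
    obtain ⟨q, hq1, hq2⟩ := exists_rat_btwn (max_lt h1 h2)
    exact mem_iUnion.2 ⟨⟨q, (le_max_left _ _).trans_lt hq1⟩, hq2,
      ((le_max_right _ _).trans hq1.le).not_gt⟩
  refine measure_mono_null hsub (measure_iUnion_null fun q => ?_)
  have hle : {s | (q : ℝ) < u s} ⊆ {s | (q : ℝ) < z s} := fun s hs => lt_of_lt_of_le hs (huz s)
  rw [measure_sdiff hle
    (measurableSet_lt measurable_const hu).nullMeasurableSet (measure_ne_top _ _)]
  exact tsub_eq_zero_of_le (h q q.2)

theorem le_measure_setOf_le {X : Type*} [MeasurableSpace X] {μ : Measure X}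
    [IsFiniteMeasure μ] {u : X → ℝ} (hu : Measurable u) {c : ℝ} (hc : 0 < c) {a : ℝ≥0∞}
    (h : ∀ θ, 0 ≤ θ → θ < c → a ≤ μ {s | θ < u s}) : a ≤ μ {s | c ≤ u s} := by
  obtain ⟨w, hw, hwlt, hwlim⟩ := exists_seq_strictMono_tendsto' hc
  have he : {s | c ≤ u s} = ⋂ n, {s | w n < u s} := by
    ext s
    simp only [mem_ofPred_eq, mem_iInter]
    exact ⟨fun h n => (hwlt n).2.trans_le h, fun h => le_of_tendsto' hwlim fun n => (h n).le⟩
  have hlim : Tendsto (fun n => μ {s | w n < u s}) atTop (𝓝 (μ (⋂ n, {s | w n < u s}))) :=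
    tendsto_measure_iInter_atTop
      (fun n => (measurableSet_lt measurable_const hu).nullMeasurableSet)
      (fun m n hmn s hs => lt_of_le_of_lt (hw.monotone hmn) hs) ⟨0, measure_ne_top _ _⟩
  rw [he]
  exact ge_of_tendsto' hlim fun n => h _ (hwlt n).1.le (hwlt n).2

/-- Two functions below `z`, at least one of them strictly wherever `z > 0`, cannot both have
the same rearrangement as `z` on `(0, α)` when `α > 1/2` and `μ {z > 0} > α`. -/
theorem false_of_measure_le {X : Type*} [MeasurableSpace X] {μ : Measure X}
    [IsProbabilityMeasure μ] {u v z : X → ℝ} (hu : Measurable u) (hv : Measurable v)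
    (hz : Measurable z) (huz : ∀ s, u s ≤ z s) (hvz : ∀ s, v s ≤ z s)
    (hlt : ∀ s, 0 < z s → u s < z s ∨ v s < z s) {α : ℝ} (hα : 1 / 2 < α)
    (hzα : ENNReal.ofReal α < μ {s | 0 < z s})
    (hud : ∀ θ, 0 ≤ θ → μ {s | θ < u s} < ENNReal.ofReal α →
      μ {s | θ < z s} ≤ μ {s | θ < u s})
    (hvd : ∀ θ, 0 ≤ θ → μ {s | θ < v s} < ENNReal.ofReal α →
      μ {s | θ < z s} ≤ μ {s | θ < v s}) : False := by
  have hα0 : 0 < α := by linarith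
  set S : Set ℝ := {θ | 0 ≤ θ ∧ μ {s | θ < z s} < ENNReal.ofReal α}
  have hne : S.Nonempty := by
    have hlim : Tendsto (fun n : ℕ => μ {s | (n : ℝ) < z s}) atTop
        (𝓝 (μ (⋂ n : ℕ, {s | (n : ℝ) < z s}))) :=
      tendsto_measure_iInter_atTop
        (fun n => (measurableSet_lt measurable_const hz).nullMeasurableSet)
        (fun m n hmn s hs => (Nat.cast_le.2 hmn : (m : ℝ) ≤ n).trans_lt hs) ⟨0, measure_ne_top _ _⟩
    have he : (⋂ n : ℕ, {s | (n : ℝ) < z s}) = ∅ := by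
      refine eq_empty_of_forall_notMem fun s hs => ?_
      obtain ⟨n, hn⟩ := exists_nat_ge (z s)
      exact absurd (mem_iInter.1 hs n) hn.not_gt
    rw [he, measure_empty] at hlim
    obtain ⟨n, hn⟩ := (hlim.eventually (gt_mem_nhds (ENNReal.ofReal_pos.2 hα0))).exists
    exact ⟨n, n.cast_nonneg, hn⟩
  have hbdd : BddBelow S := ⟨0, fun _ h => h.1⟩
  have hanti : ∀ {θ η : ℝ}, θ ≤ η → μ {s | η < z s} ≤ μ {s | θ < z s} := fun h =>
    measure_mono fun s hs => lt_of_le_of_lt h hs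
  set c := sInf S
  have hc : 0 < c := by
    have hU : {s | 0 < z s} = ⋃ n : ℕ, {s | 1 / ((n : ℝ) + 1) < z s} := by
      ext s
      simp only [mem_ofPred_eq, mem_iUnion]
      exact ⟨exists_nat_one_div_lt, fun ⟨n, hn⟩ => lt_trans (by positivity) hn⟩
    have hmono : Monotone fun n : ℕ => {s | 1 / ((n : ℝ) + 1) < z s} := fun m n hmn s hs =>
      (Nat.one_div_le_one_div hmn : 1 / ((n : ℝ) + 1) ≤ 1 / ((m : ℝ) + 1)).trans_lt hs
    rw [hU, hmono.measure_iUnion, lt_iSup_iff] at hzα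
    obtain ⟨n, hn⟩ := hzα
    refine lt_of_lt_of_le (b := 1 / ((n : ℝ) + 1)) (by positivity) (le_csInf hne fun θ hθ => ?_)
    by_contra! hlt
    exact lt_asymm (hn.trans_le (hanti hlt.le)) hθ.2
  have habove : ∀ θ, c < θ → 0 ≤ θ ∧ μ {s | θ < z s} < ENNReal.ofReal α := fun θ hθ => by
    obtain ⟨η, hη, hlt⟩ := exists_lt_of_csInf_lt hne hθ
    exact ⟨hc.le.trans hθ.le, (hanti hlt.le).trans_lt hη.2⟩
  have hbelow : ∀ θ, 0 ≤ θ → θ < c → ENNReal.ofReal α ≤ μ {s | θ < z s} := fun θ h0 hθ => by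
    by_contra! h
    exact absurd (csInf_le hbdd (show θ ∈ S from ⟨h0, h⟩)) hθ.not_ge
  have key : ∀ {w : X → ℝ}, Measurable w → (∀ s, w s ≤ z s) →
      (∀ θ, 0 ≤ θ → μ {s | θ < w s} < ENNReal.ofReal α → μ {s | θ < z s} ≤ μ {s | θ < w s}) →
      μ {s | c < z s ∧ w s < z s} = 0 ∧ ENNReal.ofReal α ≤ μ {s | c ≤ w s} := by
    intro w hw hwz hwd
    refine ⟨measure_lt_and_lt_eq_zero hw hwz fun θ hθ => ?_,
      le_measure_setOf_le hw hc fun θ h0 hθ => ?_⟩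
    · obtain ⟨h0, h1⟩ := habove θ hθ
      exact hwd θ h0 ((measure_mono fun s hs => lt_of_lt_of_le hs (hwz s)).trans_lt h1)
    · by_contra! h
      exact ((hbelow θ h0 hθ).trans (hwd θ h0 h)).not_gt h
  obtain ⟨hu0, hu1⟩ := key hu huz hud
  obtain ⟨hv0, hv1⟩ := key hv hvz hvd
  have hnull : μ ({s | c ≤ u s} ∩ {s | c ≤ v s}) = 0 := by
    refine measure_mono_null (fun s hs => ?_) (measure_union_null hu0 hv0)
    have h1 : c ≤ u s := hs.1
    have h2 : c ≤ v s := hs.2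
    rcases hlt s (hc.trans_le (h1.trans (huz s))) with h | h
    · exact Or.inl ⟨h1.trans_lt h, h⟩
    · exact Or.inr ⟨h2.trans_lt h, h⟩
  have hsum := measure_union_add_inter (μ := μ) {s | c ≤ u s}
    (measurableSet_le (measurable_const (a := c)) hv)
  rw [hnull, add_zero] at hsum
  have h2 : ENNReal.ofReal (α + α) ≤ 1 := by
    rw [ENNReal.ofReal_add hα0.le hα0.le]
    exact (add_le_add hu1 hv1).trans (hsum ▸ prob_le_one)
  rw [ENNReal.ofReal_le_one] at h2
  linarith

/-- If `1/2 < α < 1` and `μ{t : max{|x(t)|,|y(t)|} > 0} > α`, then for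
some `t ∈ [0,α)` one of the rearrangement inequalities is strict. -/
theorem exists_strict_rearr_inequality
    (φ ω : ℝ → ℝ) (hφ : IsOrliczFunction φ) (hω : IsWeight (Set.Ico 0 1) ω)
    (α : ℝ) (hα : α = sSup {t : ℝ | 0 ≤ t ∧ 0 < ω t})
    (hα₁ : 1 / 2 < α) (hα₂ : α < 1)
    (x y : ℝ → ℝ) (hx : MemOL (Set.Ico 0 1) φ ω x) (hy : MemOL (Set.Ico 0 1) φ ω y)
    (hxn : orliczNorm (Set.Ico 0 1) φ ω x = 1)
    (hyn : orliczNorm (Set.Ico 0 1) φ ω y = 1)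
    (k₁ k₂ : ℝ) (hk₁ : k₁ ∈ KSet (Set.Ico 0 1) φ ω x)
    (hk₂ : k₂ ∈ KSet (Set.Ico 0 1) φ ω y)
    (k : ℝ) (hk : k = 2 * k₁ * k₂ / (k₁ + k₂))
    (hμ : ENNReal.ofReal α <
      volume {t ∈ Set.Ico (0:ℝ) 1 | 0 < max |x t| |y t|}) :
    ∃ t ∈ Set.Ico (0:ℝ) α,
      φ (rearr (Set.Ico 0 1) (fun s => k * (x s + y s) / 2) t) <
        rearr (Set.Ico 0 1)
          (fun s => k₂ / (k₁ + k₂) * φ (k₁ * x s) + k₁ / (k₁ + k₂) * φ (k₂ * y s)) t ∨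
      φ (rearr (Set.Ico 0 1) (fun s => k * (x s - y s) / 2) t) <
        rearr (Set.Ico 0 1)
          (fun s => k₂ / (k₁ + k₂) * φ (k₁ * x s) + k₁ / (k₁ + k₂) * φ (k₂ * y s)) t := by
  by_contra! hcon
  have hk₁0 : 0 < k₁ := hk₁.1
  have hk₂0 : 0 < k₂ := hk₂.1
  have hs0 : 0 < k₁ + k₂ := add_pos hk₁0 hk₂0
  have ha : 0 < k₂ / (k₁ + k₂) := div_pos hk₂0 hs0
  have hb : 0 < k₁ / (k₁ + k₂) := div_pos hk₁0 hs0
  have hab : k₂ / (k₁ + k₂) + k₁ / (k₁ + k₂) = 1 := by field_simp; ring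
  have hxm := hx.1
  have hym := hy.1
  have hφm := hφ.continuous_s15.measurable
  have hD : volume (Ico (0 : ℝ) 1) ≠ ⊤ := by simp
  have : IsProbabilityMeasure (volume.restrict (Ico (0 : ℝ) 1)) := ⟨by simp⟩
  have hfp : (fun s => k * (x s + y s) / 2) = fun s =>
      k₂ / (k₁ + k₂) * (k₁ * x s) + k₁ / (k₁ + k₂) * (k₂ * y s) := by
    ext s; rw [hk]; field_simp
  have hfm : (fun s => k * (x s - y s) / 2) = fun s =>
      k₂ / (k₁ + k₂) * (k₁ * x s) - k₁ / (k₁ + k₂) * (k₂ * y s) := by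
    ext s; rw [hk]; field_simp
  rw [hfp, hfm] at hcon
  set z : ℝ → ℝ := fun s => k₂ / (k₁ + k₂) * φ (k₁ * x s) + k₁ / (k₁ + k₂) * φ (k₂ * y s)
    with hzdef
  have hzm : Measurable z := by fun_prop
  have hz0 : ∀ s, |z s| = z s := fun s => abs_of_nonneg <|
    add_nonneg (mul_nonneg ha.le (hφ.2.2.2.2.1 _)) (mul_nonneg hb.le (hφ.2.2.2.2.1 _))
  have hstrict : ∀ s, x s ≠ 0 ∨ y s ≠ 0 →
      φ (k₂ / (k₁ + k₂) * (k₁ * x s) + k₁ / (k₁ + k₂) * (k₂ * y s)) < z s ∨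
      φ (k₂ / (k₁ + k₂) * (k₁ * x s) - k₁ / (k₁ + k₂) * (k₂ * y s)) < z s := fun s h =>
    hφ.convex_lt ha hb hab (h.imp (mul_ne_zero hk₁0.ne') (mul_ne_zero hk₂0.ne'))
  refine false_of_measure_le (μ := volume.restrict (Ico (0 : ℝ) 1))
    (u := fun s => φ (k₂ / (k₁ + k₂) * (k₁ * x s) + k₁ / (k₁ + k₂) * (k₂ * y s)))
    (v := fun s => φ (k₂ / (k₁ + k₂) * (k₁ * x s) - k₁ / (k₁ + k₂) * (k₂ * y s)))
    (z := z) (by fun_prop) (by fun_prop) hzm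
    (fun s => hφ.convex_add_le ha hb hab _ _) (fun s => hφ.convex_sub_le ha hb hab _ _)
    (fun s hs => hstrict s ?_) hα₁ ?_ (fun θ hθ h => ?_) (fun θ hθ h => ?_)
  · by_contra! h
    simp [hzdef, h.1, h.2, hφ.2.2.1] at hs
  · rw [Measure.restrict_apply' measurableSet_Ico, inter_comm]
    refine hμ.trans_le (measure_mono fun s hs => ⟨hs.1, ?_⟩)
    have hne : x s ≠ 0 ∨ y s ≠ 0 := (lt_max_iff.1 hs.2).imp abs_pos.1 abs_pos.1
    rcases hstrict s hne with h | h <;> exact (hφ.2.2.2.2.1 _).trans_lt h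
  · simpa only [hz0] using hφ.measure_le_of_rearr_le measurableSet_Ico hD (by fun_prop) hzm
      (fun t h0 h1 => (hcon t ⟨h0.le, h1⟩).1) hθ h
  · simpa only [hz0] using hφ.measure_le_of_rearr_le measurableSet_Ico hD (by fun_prop) hzm
      (fun t h0 h1 => (hcon t ⟨h0.le, h1⟩).2) hθ h
end
end
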